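/- arXiv:math/0203170 — 3 statements merged into one kernel-verified Lean document; each statement's English description precedes it below -/
import Mathlib

section
/- Let G be the graph product of a finite simple graph Γ = (V,E) with nontrivial finite vertex groups (G_v)_{v∈V}. A subgroup F of G is a maximal finite subgroup of G (i.e., F is finite and is not properly contained in any finite subgroup of G) if and only if there exists a clique C of Γ and an element g ∈ G such that F = gG(C)g⁻¹. -/
open Monoid

/-- The set of commutator relators defining a graph product. -/
def graphProdRels {V : Type*} (Γ : SimpleGraph V) (G : V → Type*) [∀ v, Group (G v)] :
    Set (CoprodI G) :=
  {x | ∃ (u v : V) (_ : Γ.Adj u v) (g : G u) (h : G v),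
    x = (CoprodI.of g)⁻¹ * (CoprodI.of h)⁻¹ * CoprodI.of g * CoprodI.of h}

/-- The graph product of the graph of groups `(Γ, G)`: the quotient of the free product of the
vertex groups by the normal closure of the commutators of elements of pairs of adjacent vertex
groups. -/
def GraphProduct {V : Type*} (Γ : SimpleGraph V) (G : V → Type*) [∀ v, Group (G v)] : Type _ :=
  CoprodI G ⧸ Subgroup.normalClosure (graphProdRels Γ G)

instance {V : Type*} (Γ : SimpleGraph V) (G : V → Type*) [∀ v, Group (G v)] :
    Group (GraphProduct Γ G) :=
  QuotientGroup.Quotient.group _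

/-- The canonical map from a vertex group into the graph product. -/
def GraphProduct.of {V : Type*} (Γ : SimpleGraph V) (G : V → Type*) [∀ v, Group (G v)] (v : V) :
    G v →* GraphProduct Γ G :=
  (QuotientGroup.mk' _).comp CoprodI.of

/-- `G(A)`: the subgroup of the graph product generated by the images of the vertex groups
`G_a`, `a ∈ A`. -/
def GraphProduct.vsub {V : Type*} (Γ : SimpleGraph V) (G : V → Type*) [∀ v, Group (G v)]
    (A : Set V) : Subgroup (GraphProduct Γ G) :=
  ⨆ a ∈ A, (GraphProduct.of Γ G a).range

/-- A clique of a graph: a maximal set of pairwise adjacent vertices. -/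
def IsMaxClique {V : Type*} (Γ : SimpleGraph V) (C : Set V) : Prop :=
  Γ.IsClique C ∧ ∀ D : Set V, Γ.IsClique D → C ⊆ D → C = D


namespace GPAux

open Monoid

section FreeProd

/-- The free product of copies of `K` indexed by `I`. -/
abbrev FP (I K : Type*) [Group K] : Type _ := CoprodI (fun _ : I => K)

variable {I K : Type*} [Group K]

/-- The inclusion of the `i`-th copy. -/
def ofI (i : I) : K →* FP I K := CoprodI.of (M := fun _ : I => K) (i := i)

/-- Reduced lists. -/
def Red (l : List (Σ _ : I, K)) : Prop :=
  (∀ p ∈ l, p.2 ≠ 1) ∧ l.IsChain (fun a b => a.1 ≠ b.1)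

/-- Product of a list of letters. -/
def pr (l : List (Σ _ : I, K)) : FP I K := (l.map fun p => ofI p.1 p.2).prod

open Classical in
/-- Syllable length. -/
noncomputable def len (x : FP I K) : ℕ :=
  (CoprodI.Word.equiv (M := fun _ : I => K) x).toList.length

theorem len_pr {l : List (Σ _ : I, K)} (h : Red l) : len (pr l) = l.length := by
  classical
  have : pr l = (CoprodI.Word.equiv (M := fun _ : I => K)).symm ⟨l, h.1, h.2⟩ := rfl
  rw [this]
  unfold len
  convert congrArg (fun w : CoprodI.Word (fun _ : I => K) => w.toList.length)
    (Equiv.apply_symm_apply (CoprodI.Word.equiv (M := fun _ : I => K)) ⟨l, h.1, h.2⟩)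

theorem exists_red (x : FP I K) : ∃ l, Red l ∧ x = pr l := by
  classical
  refine ⟨(CoprodI.Word.equiv (M := fun _ : I => K) x).toList, ⟨?_, ?_⟩, ?_⟩
  · exact (CoprodI.Word.equiv (M := fun _ : I => K) x).ne_one
  · exact (CoprodI.Word.equiv (M := fun _ : I => K) x).chain_ne
  · exact (Equiv.symm_apply_apply (CoprodI.Word.equiv (M := fun _ : I => K)) x).symm

@[simp] theorem pr_nil : pr ([] : List (Σ _ : I, K)) = 1 := rfl

@[simp] theorem pr_cons (i : I) (k : K) (l : List (Σ _ : I, K)) :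
    pr (⟨i, k⟩ :: l) = ofI i k * pr l := by simp [pr]

@[simp] theorem pr_append (l l' : List (Σ _ : I, K)) : pr (l ++ l') = pr l * pr l' := by
  simp [pr]

/-- inverse list -/
def invl (l : List (Σ _ : I, K)) : List (Σ _ : I, K) :=
  (l.map fun p => ⟨p.1, p.2⁻¹⟩).reverse

@[simp] theorem invl_cons (i : I) (k : K) (l : List (Σ _ : I, K)) :
    invl (⟨i, k⟩ :: l) = invl l ++ [⟨i, k⁻¹⟩] := by simp [invl]

@[simp] theorem length_invl (l : List (Σ _ : I, K)) : (invl l).length = l.length := by simp [invl]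

theorem pr_invl (l : List (Σ _ : I, K)) : pr (invl l) = (pr l)⁻¹ := by
  induction l with
  | nil => simp [invl]
  | cons a l ih => obtain ⟨i, k⟩ := a; simp [ih]

theorem red_cons {i : I} {k : K} {l : List (Σ _ : I, K)} :
    Red (⟨i, k⟩ :: l) ↔ k ≠ 1 ∧ (∀ p ∈ l.head?, i ≠ p.1) ∧ Red l := by
  simp only [Red, List.isChain_cons, List.mem_cons, forall_eq_or_imp]
  tauto

theorem red_append {l l' : List (Σ _ : I, K)} :
    Red (l ++ l') ↔ Red l ∧ Red l' ∧ ∀ p ∈ l.getLast?, ∀ q ∈ l'.head?, p.1 ≠ q.1 := by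
  simp only [Red, List.isChain_append, List.mem_append, or_imp, forall_and]
  tauto

theorem red_invl {l : List (Σ _ : I, K)} (h : Red l) : Red (invl l) := by
  refine ⟨?_, ?_⟩
  · simp only [invl, List.mem_reverse, List.mem_map]
    rintro _ ⟨p, hp, rfl⟩
    simpa using h.1 p hp
  · simp only [invl, List.isChain_reverse, List.isChain_map]
    exact h.2.imp fun a b hab => hab.symm

theorem getLast_invl (l : List (Σ _ : I, K)) :
    (invl l).getLast? = l.head?.map fun p => ⟨p.1, p.2⁻¹⟩ := by
  simp [invl]

/-- Key geometric step. -/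
theorem key_step (w1 w : List (Σ _ : I, K)) (i : I) (k : K) (h1 : Red (⟨i, k⟩ :: w1))
    (hw : Red w) (hne : w1 ≠ []) (R : ℕ) (hR : len (pr w) ≤ R)
    (hR' : len ((pr (⟨i, k⟩ :: w1))⁻¹ * pr w) ≤ R) : len ((ofI i k)⁻¹ * pr w) < R := by
  have hn : 1 ≤ w1.length := List.length_pos_iff.2 hne
  have hk := (red_cons.1 h1).1
  have h1t := (red_cons.1 h1).2.2
  have h1h := (red_cons.1 h1).2.1
  rw [len_pr hw] at hR
  by_cases hh : ∀ p ∈ w.head?, i ≠ p.1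
  · have e1 : Red (invl (⟨i, k⟩ :: w1) ++ w) := by
      refine red_append.2 ⟨red_invl h1, hw, ?_⟩
      rw [getLast_invl]
      simpa using hh
    have e2 : Red (⟨i, k⁻¹⟩ :: w) := red_cons.2 ⟨by simpa using hk, hh, hw⟩
    have e3 := len_pr e1
    rw [pr_append, pr_invl] at e3
    have e4 := len_pr e2
    rw [pr_cons, map_inv] at e4
    rw [e3] at hR'
    rw [e4]
    simp at hR' ⊢
    omega
  · cases w with
    | nil => simp at hh
    | cons a w' =>
      obtain ⟨j, k'⟩ := a
      have hij : i = j := by simpa using hh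
      subst hij
      have hw' := red_cons.1 hw
      by_cases hkk : k' = k
      · subst hkk
        rw [pr_cons, inv_mul_cancel_left, len_pr hw'.2.2]
        simpa using hR
      · have hk2 : k⁻¹ * k' ≠ 1 := fun h => hkk (by rw [inv_mul_eq_one] at h; exact h.symm)
        have e2 : Red (⟨i, k⁻¹ * k'⟩ :: w') := red_cons.2 ⟨hk2, hw'.2⟩
        have e1 : Red (invl w1 ++ ⟨i, k⁻¹ * k'⟩ :: w') := by
          refine red_append.2 ⟨red_invl h1t, e2, ?_⟩
          rw [getLast_invl]
          intro p hp q hq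
          simp only [Option.mem_def, Option.map_eq_some_iff] at hp
          obtain ⟨p', hp', rfl⟩ := hp
          simp only [List.head?_cons, Option.mem_def, Option.some.injEq] at hq
          subst hq
          exact (h1h p' hp').symm
        have e3 := len_pr e1
        have e4 := len_pr e2
        have q1 : (pr (⟨i, k⟩ :: w1))⁻¹ * pr (⟨i, k'⟩ :: w') =
            pr (invl w1 ++ ⟨i, k⁻¹ * k'⟩ :: w') := by
          simp [pr_invl, mul_assoc]
        have q2 : (ofI i k)⁻¹ * pr (⟨i, k'⟩ :: w') = pr (⟨i, k⁻¹ * k'⟩ :: w') := by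
          simp [mul_assoc]
        rw [q1, e3] at hR'
        rw [q2, e4]
        simp at hR' hR ⊢
        omega

theorem len_le_one {x : FP I K} (h : len x ≤ 1) : x = 1 ∨ ∃ i k, k ≠ 1 ∧ x = ofI i k := by
  obtain ⟨l, hl, rfl⟩ := exists_red x
  rw [len_pr hl] at h
  match l, hl, h with
  | [], _, _ => left; rfl
  | [⟨i, k⟩], hl, _ => exact Or.inr ⟨i, k, (red_cons.1 hl).1, by simp⟩
  | a :: b :: l, _, h => simp at h

/-- Two minimizers of the eccentricity differ by at most one syllable. -/
theorem center (S : Set (FP I K)) (R : ℕ) (hmin : ¬ ∃ m, ∀ s ∈ S, len (m⁻¹ * s) < R)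
    (m m' : FP I K) (hm : ∀ s ∈ S, len (m⁻¹ * s) ≤ R) (hm' : ∀ s ∈ S, len (m'⁻¹ * s) ≤ R) :
    len (m⁻¹ * m') ≤ 1 := by
  by_contra hlt
  obtain ⟨l, hl, hx⟩ := exists_red (m⁻¹ * m')
  rw [hx, len_pr hl] at hlt
  match l, hl, hlt, hx with
  | [], _, h, _ => simp at h
  | [a], _, h, _ => simp at h
  | ⟨i, k⟩ :: b :: t, hl, h, hx =>
    apply hmin
    refine ⟨m * ofI i k, fun s hs => ?_⟩
    obtain ⟨w, hw, hws⟩ := exists_red (m⁻¹ * s)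
    have := key_step (b :: t) w i k hl hw (by simp) R (hws ▸ hm s hs) (by
      rw [← hx, ← hws]
      have := hm' s hs
      simpa [mul_assoc] using this)
    rw [← hws] at this
    simpa [mul_assoc] using this

theorem len_two {i j : I} {a b : K} (ha : a ≠ 1) (hb : b ≠ 1)
    (h : len (ofI i a * ofI j b) ≤ 1) : i = j := by
  by_contra hij
  have e : Red [⟨i, a⟩, ⟨j, b⟩] := by
    refine red_cons.2 ⟨ha, ?_, red_cons.2 ⟨hb, ?_, ?_⟩⟩
    · simpa using hij
    · simp
    · simp [Red]
  have := len_pr e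
  simp at this
  omega

theorem ofI_inj_idx {i j : I} {a b : K} (ha : a ≠ 1) (h : ofI i a = ofI j b) : i = j := by
  by_cases hb : b = 1
  · subst hb
    have : ofI i a = 1 := by rw [h, map_one]
    exact absurd ((map_eq_one_iff _ (CoprodI.of_injective (M := fun _ : I => K) i)).1 this) ha
  · by_contra hij
    have e : Red [⟨i, a⟩, ⟨j, b⁻¹⟩] := by
      refine red_cons.2 ⟨ha, ?_, red_cons.2 ⟨by simpa using hb, ?_, ?_⟩⟩
      · simpa using hij
      · simp
      · simp [Red]
    have := len_pr e
    simp [h] at this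
    have e0 := len_pr (show Red ([] : List (Σ _ : I, K)) by simp [Red])
    simp at e0
    omega

/-- Permutation of the factors. -/
def permHom (H : Type*) [Group H] [MulAction H I] (h : H) : FP I K →* FP I K :=
  CoprodI.lift fun i => ofI (h • i)

@[simp] theorem permHom_of (H : Type*) [Group H] [MulAction H I] (h : H) (i : I) (k : K) :
    permHom H h (ofI i k) = ofI (h • i) k := by
  simp [permHom, ofI]

/-- The action of `H` on the free product by permuting the factors. -/
def perm (H : Type*) [Group H] [MulAction H I] : H →* MulAut (FP I K) where
  toFun h := MonoidHom.toMulEquiv (permHom H h) (permHom H h⁻¹)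
    (CoprodI.ext_hom _ _ fun i => MonoidHom.ext fun k => by
      change permHom H h⁻¹ (permHom H h (ofI i k)) = ofI i k
      simp)
    (CoprodI.ext_hom _ _ fun i => MonoidHom.ext fun k => by
      change permHom H h (permHom H h⁻¹ (ofI i k)) = ofI i k
      simp)
  map_one' := by
    apply MulEquiv.toMonoidHom_injective
    refine CoprodI.ext_hom _ _ fun i => MonoidHom.ext fun k => ?_
    change permHom H 1 (ofI i k) = ofI i k
    simp
  map_mul' a b := by
    apply MulEquiv.toMonoidHom_injective
    refine CoprodI.ext_hom _ _ fun i => MonoidHom.ext fun k => ?_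
    change permHom H (a * b) (ofI i k) = permHom H a (permHom H b (ofI i k))
    simp [mul_smul]

@[simp] theorem perm_of (H : Type*) [Group H] [MulAction H I] (h : H) (i : I) (k : K) :
    perm H h (ofI i k) = ofI (h • i) k := permHom_of H h i k

theorem len_perm (H : Type*) [Group H] [MulAction H I] (h : H) (x : FP I K) :
    len (perm H h x) = len x := by
  obtain ⟨l, hl, rfl⟩ := exists_red x
  have e : perm H h (pr l) = pr (l.map fun p => ⟨h • p.1, p.2⟩) := by
    clear hl
    induction l with
    | nil => simp
    | cons a l ih => obtain ⟨i, k⟩ := a; simp [ih]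
  rw [e, len_pr hl, len_pr, List.length_map]
  refine ⟨?_, ?_⟩
  · simp only [List.mem_map]
    rintro _ ⟨p, hp, rfl⟩
    exact hl.1 p hp
  · rw [List.isChain_map]
    exact hl.2.imp fun a b hab => by simpa using hab

/-- Fixed point theorem: a finite subgroup of `FP ⋊ H` fixes a vertex of the tree. -/
theorem fixed_point (H : Type*) [Group H] [MulAction H I]
    (Q : Subgroup (FP I K ⋊[perm (I := I) (K := K) H] H)) [Finite Q] :
    ∃ m : FP I K, (∀ q ∈ Q, q.left * perm H q.right m = m) ∨
      ∃ i : I, ∀ q ∈ Q, q.right • i = i ∧ ∃ a : K, q.left * perm H q.right m = m * ofI i a := by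
  classical
  set act : (FP I K ⋊[perm (I := I) (K := K) H] H) → FP I K → FP I K :=
    fun q m => q.left * perm H q.right m with hact
  have act_d : ∀ q m m', (act q m)⁻¹ * act q m' = perm H q.right (m⁻¹ * m') := by
    intro q m m'
    simp [hact, mul_assoc]
  have act_mul : ∀ q q' m, act (q * q') m = act q (act q' m) := by
    intro q q' m
    simp [hact, mul_assoc]
  let S : Set (FP I K) := (fun q => act q 1) '' (Q : Set _)
  have hSfin : S.Finite := Set.Finite.image _ (Set.toFinite (Q : Set (FP I K ⋊[perm (I := I) (K := K) H] H)))
  have hS1 : (1 : FP I K) ∈ S := ⟨1, Q.one_mem, by simp [hact]⟩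
  have hSinv : ∀ q ∈ Q, ∀ s ∈ S, act q s ∈ S := by
    rintro q hq _ ⟨q', hq', rfl⟩
    exact ⟨q * q', Q.mul_mem hq hq', act_mul _ _ _⟩
  have hex : ∃ R, ∃ m : FP I K, ∀ s ∈ S, len (m⁻¹ * s) ≤ R := by
    obtain ⟨R, hR⟩ := (hSfin.image fun s => len ((1 : FP I K)⁻¹ * s)).bddAbove
    exact ⟨R, 1, fun s hs => hR ⟨s, hs, rfl⟩⟩
  obtain ⟨m, hm⟩ := Nat.find_spec hex
  have hlow := fun n => Nat.find_min (m := n) hex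
  generalize Nat.find hex = R at hm hlow
  have hmin : ¬ ∃ m : FP I K, ∀ s ∈ S, len (m⁻¹ * s) < R := by
    rintro ⟨m', hm'⟩
    have h0 := hm' 1 hS1
    exact hlow (R - 1) (by omega) ⟨m', fun s hs => by have := hm' s hs; omega⟩
  have hinv : ∀ q ∈ Q, ∀ p, (∀ s ∈ S, len (p⁻¹ * s) ≤ R) →
      ∀ s ∈ S, len ((act q p)⁻¹ * s) ≤ R := by
    intro q hq p hp s hs
    have e : s = act q (act q⁻¹ s) := by
      rw [← act_mul]; simp [hact]
    rw [e, act_d, len_perm]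
    exact hp _ (hSinv _ (Q.inv_mem hq) _ hs)
  have hc := center S R hmin
  refine ⟨m, ?_⟩
  by_cases huniq : ∀ m', (∀ s ∈ S, len (m'⁻¹ * s) ≤ R) → m' = m
  · left
    intro q hq
    exact huniq _ (hinv q hq m hm)
  · right
    push Not at huniq
    obtain ⟨m', hm', hne⟩ := huniq
    have hne' : m⁻¹ * m' ≠ 1 := fun h => hne (by rw [inv_mul_eq_one] at h; exact h.symm)
    obtain h | ⟨i, k, hk, hmk⟩ := len_le_one (hc m m' hm hm')
    · exact absurd h hne'
    have hcoset : ∀ p, (∀ s ∈ S, len (p⁻¹ * s) ≤ R) → ∃ a, m⁻¹ * p = ofI i a := by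
      intro p hp
      obtain h | ⟨j, a, ha, hpa⟩ := len_le_one (hc m p hm hp)
      · exact ⟨1, by rw [h, map_one]⟩
      · have h2 := hc p m' hp hm'
        have e : p⁻¹ * m' = ofI j a⁻¹ * ofI i k := by
          rw [map_inv, ← hpa, ← hmk]; group
        rw [e] at h2
        have := len_two (by simpa using ha) hk h2
        subst this
        exact ⟨a, hpa⟩
    refine ⟨i, fun q hq => ?_⟩
    obtain ⟨a, ha⟩ := hcoset _ (hinv q hq m hm)
    obtain ⟨b, hb⟩ := hcoset _ (hinv q hq m' hm')
    refine ⟨?_, a, ?_⟩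
    · have e := act_d q m m'
      have e2 : (act q m)⁻¹ * act q m' = ofI i (a⁻¹ * b) := by
        rw [map_mul, map_inv, ← ha, ← hb]; group
      rw [e2, hmk, perm_of] at e
      exact (ofI_inj_idx hk e.symm)
    · rw [← ha]; simp [hact]

end FreeProd

section GP

variable {V : Type*} (Γ : SimpleGraph V) (G : V → Type*) [∀ v, Group (G v)]

variable {Γ G} in
/-- Universal property of the graph product. -/
def liftGP {H : Type*} [Group H] (f : ∀ v, G v →* H)
    (hf : ∀ u v, Γ.Adj u v → ∀ g h, Commute (f u g) (f v h)) : GraphProduct Γ G →* H :=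
  QuotientGroup.lift _ (CoprodI.lift f) (by
    intro x hx
    have : Subgroup.normalClosure (graphProdRels Γ G) ≤ (CoprodI.lift f).ker := by
      apply Subgroup.normalClosure_le_normal
      rintro _ ⟨u, v, huv, g, h, rfl⟩
      have := (hf u v huv g h).eq
      simp only [SetLike.mem_coe, MonoidHom.mem_ker, map_mul, map_inv, CoprodI.lift_of]
      rw [mul_assoc, this]
      group
    exact this hx)

@[simp] theorem liftGP_of {H : Type*} [Group H] (f : ∀ v, G v →* H)
    (hf : ∀ u v, Γ.Adj u v → ∀ g h, Commute (f u g) (f v h)) (v : V) (g : G v) :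
    liftGP f hf (GraphProduct.of Γ G v g) = f v g :=
  CoprodI.lift_of f g

theorem of_commute {u v : V} (h : Γ.Adj u v) (x : G u) (y : G v) :
    Commute (GraphProduct.of Γ G u x) (GraphProduct.of Γ G v y) := by
  have : (CoprodI.of x)⁻¹ * (CoprodI.of y)⁻¹ * CoprodI.of x * CoprodI.of y ∈
      Subgroup.normalClosure (graphProdRels Γ G) :=
    Subgroup.subset_normalClosure ⟨u, v, h, x, y, rfl⟩
  have h2 := (QuotientGroup.eq_one_iff _).2 this
  have h3 : (GraphProduct.of Γ G u x)⁻¹ * (GraphProduct.of Γ G v y)⁻¹ * GraphProduct.of Γ G u x *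
    GraphProduct.of Γ G v y = 1 := h2
  rw [mul_assoc, ← mul_inv_rev, inv_mul_eq_one] at h3
  exact h3.symm

theorem of_mem {A : Set V} {v : V} (hv : v ∈ A) (g : G v) :
    GraphProduct.of Γ G v g ∈ GraphProduct.vsub Γ G A :=
  (le_iSup₂ (f := fun a (_ : a ∈ A) => (GraphProduct.of Γ G a).range) v hv) ⟨g, rfl⟩

variable {Γ G} in
theorem vsub_le {A : Set V} {S : Subgroup (GraphProduct Γ G)}
    (h : ∀ a ∈ A, ∀ g, GraphProduct.of Γ G a g ∈ S) : GraphProduct.vsub Γ G A ≤ S := by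
  refine iSup₂_le fun a ha => ?_
  rintro _ ⟨g, rfl⟩
  exact h a ha g

theorem vsub_mono {A B : Set V} (h : A ⊆ B) : GraphProduct.vsub Γ G A ≤ GraphProduct.vsub Γ G B :=
  vsub_le fun _ ha g => of_mem Γ G (h ha) g

theorem gen_top {S : Subgroup (GraphProduct Γ G)} (h : ∀ a g, GraphProduct.of Γ G a g ∈ S)
    (x : GraphProduct Γ G) : x ∈ S := by
  obtain ⟨y, rfl⟩ := QuotientGroup.mk'_surjective _ x
  induction y using CoprodI.induction_on with
  | one => exact S.one_mem
  | of i m => exact h i m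
  | mul x y hx hy => rw [map_mul]; exact S.mul_mem hx hy

open Classical in
/-- The retraction onto `G(A)`. -/
noncomputable def retr (A : Set V) : GraphProduct Γ G →* GraphProduct Γ G :=
  liftGP (fun v => if v ∈ A then GraphProduct.of Γ G v else 1) (by
    intro u v huv g h
    by_cases hu : u ∈ A <;> by_cases hv : v ∈ A <;> simp [hu, hv, of_commute Γ G huv])

theorem retr_of_mem {A : Set V} {v : V} (hv : v ∈ A) (g : G v) :
    retr Γ G A (GraphProduct.of Γ G v g) = GraphProduct.of Γ G v g := by
  simp [retr, hv]

theorem retr_of_not_mem {A : Set V} {v : V} (hv : v ∉ A) (g : G v) :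
    retr Γ G A (GraphProduct.of Γ G v g) = 1 := by
  simp [retr, hv]

theorem retr_eq {A : Set V} {x : GraphProduct Γ G} (hx : x ∈ GraphProduct.vsub Γ G A) :
    retr Γ G A x = x := by
  have : GraphProduct.vsub Γ G A ≤ (retr Γ G A).eqLocus (MonoidHom.id _) :=
    vsub_le fun a ha g => retr_of_mem Γ G ha g
  exact this hx

theorem retr_mem (A : Set V) (x : GraphProduct Γ G) :
    retr Γ G A x ∈ GraphProduct.vsub Γ G A := by
  refine gen_top Γ G (S := (GraphProduct.vsub Γ G A).comap (retr Γ G A)) (fun a g => ?_) x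
  rw [Subgroup.mem_comap]
  by_cases ha : a ∈ A
  · rw [retr_of_mem Γ G ha]; exact of_mem Γ G ha g
  · rw [retr_of_not_mem Γ G ha]; exact Subgroup.one_mem _

theorem finite_vsub [Fintype V] [∀ v, Finite (G v)] {C : Set V} (hC : Γ.IsClique C) :
    Finite (GraphProduct.vsub Γ G C) := by
  classical
  let f : ∀ v, G v →* GraphProduct Γ G := fun v => if v ∈ C then GraphProduct.of Γ G v else 1
  have hf : Pairwise fun u v => ∀ g h, Commute (f u g) (f v h) := by
    intro u v huv g h
    by_cases hu : u ∈ C <;> by_cases hv : v ∈ C <;> simp [f, hu, hv]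
    exact of_commute Γ G (hC hu hv huv) g h
  have hle : GraphProduct.vsub Γ G C ≤ (MonoidHom.noncommPiCoprod f hf).range := by
    refine vsub_le fun a ha g => ⟨Pi.mulSingle a g, ?_⟩
    rw [MonoidHom.noncommPiCoprod_mulSingle]
    simp [f, ha]
  have : Finite (MonoidHom.noncommPiCoprod f hf).range :=
    Finite.of_surjective _ (MonoidHom.rangeRestrict_surjective _)
  exact Finite.of_injective _ (Subgroup.inclusion_injective hle)

open Classical in
/-- The projection to a vertex group. -/
noncomputable def proj (v : V) : GraphProduct Γ G →* G v :=
  liftGP (Pi.mulSingle v (MonoidHom.id (G v))) (by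
    intro a b hab g h
    by_cases ha : a = v
    · have hb : b ≠ v := fun hb => hab.ne (ha.trans hb.symm)
      simp [Pi.mulSingle_eq_of_ne hb]
    · simp [Pi.mulSingle_eq_of_ne ha])

theorem proj_same (v : V) (g : G v) : proj Γ G v (GraphProduct.of Γ G v g) = g := by
  simp [proj]

theorem proj_ne {u v : V} (h : u ≠ v) (g : G u) : proj Γ G v (GraphProduct.of Γ G u g) = 1 := by
  classical
  simp [proj, Pi.mulSingle_eq_of_ne h]

section Tree

variable (v : V) (A : Set V)

/-- `L = G(lk v ∩ A)`. -/
abbrev Lk : Subgroup (GraphProduct Γ G) := GraphProduct.vsub Γ G {u | Γ.Adj v u ∧ u ∈ A}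

/-- index set of the free product -/
abbrev Idx : Type _ := GraphProduct Γ G ⧸ Lk Γ G v A

/-- the semidirect product -/
abbrev SD : Type _ :=
  FP (Idx Γ G v A) (G v) ⋊[perm (I := Idx Γ G v A) (K := G v) (GraphProduct Γ G)] GraphProduct Γ G

theorem lk_commute {x : GraphProduct Γ G} (hx : x ∈ Lk Γ G v A) (k : G v) :
    Commute x (GraphProduct.of Γ G v k) := by
  have : Lk Γ G v A ≤ Subgroup.centralizer {GraphProduct.of Γ G v k} := by
    refine vsub_le fun a ha g => ?_
    rw [Subgroup.mem_centralizer_singleton_iff]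
    exact (of_commute Γ G ha.1.symm g k).eq
  have := this hx
  rw [Subgroup.mem_centralizer_singleton_iff] at this
  exact this

/-- The map from the free product to the graph product. -/
noncomputable def psiN : FP (Idx Γ G v A) (G v) →* GraphProduct Γ G :=
  CoprodI.lift fun i =>
    (MulAut.conj (Quotient.out i)).toMonoidHom.comp (GraphProduct.of Γ G v)

theorem psiN_of (a : GraphProduct Γ G) (k : G v) :
    psiN Γ G v A (ofI (a : Idx Γ G v A) k) = a * GraphProduct.of Γ G v k * a⁻¹ := by
  simp only [psiN, ofI, CoprodI.lift_of]
  obtain ⟨l, hl⟩ := QuotientGroup.mk_out_eq_mul (Lk Γ G v A) a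
  change (Quotient.out (a : Idx Γ G v A)) * GraphProduct.of Γ G v k *
    (Quotient.out (a : Idx Γ G v A))⁻¹ = _
  rw [hl]
  have := (lk_commute Γ G v A l.2 k).eq
  rw [mul_assoc a, this]
  group

/-- The map from the semidirect product to the graph product. -/
noncomputable def psi : SD Γ G v A →* GraphProduct Γ G :=
  SemidirectProduct.lift (psiN Γ G v A) (MonoidHom.id _) (by
    intro h
    refine CoprodI.ext_hom _ _ fun i => MonoidHom.ext fun k => ?_
    obtain ⟨a, rfl⟩ := QuotientGroup.mk_surjective i
    change psiN Γ G v A (perm _ h (ofI (a : Idx Γ G v A) k)) =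
      h * psiN Γ G v A (ofI (a : Idx Γ G v A) k) * h⁻¹
    rw [perm_of, psiN_of]
    have : h • (a : Idx Γ G v A) = ((h * a : GraphProduct Γ G) : Idx Γ G v A) := rfl
    rw [this, psiN_of]
    group)

open Classical in
/-- Vertex maps to the semidirect product. -/
noncomputable def phiF (u : V) : G u →* SD Γ G v A :=
  if h : u = v then
    SemidirectProduct.inl.comp (h ▸ ofI (K := G v) ((1 : GraphProduct Γ G) : Idx Γ G v A))
  else if u ∈ A then SemidirectProduct.inr.comp (GraphProduct.of Γ G u) else 1

theorem phiF_self : phiF Γ G v A v =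
    SemidirectProduct.inl.comp (ofI (K := G v) ((1 : GraphProduct Γ G) : Idx Γ G v A)) := by
  simp [phiF]

theorem phiF_mem {u : V} (h : u ≠ v) (hu : u ∈ A) : phiF Γ G v A u =
    SemidirectProduct.inr.comp (GraphProduct.of Γ G u) := by
  simp [phiF, h, hu]

theorem phiF_not_mem {u : V} (h : u ≠ v) (hu : u ∉ A) : phiF Γ G v A u = 1 := by
  simp [phiF, h, hu]

theorem phiF_comm_aux {u : V} (h : Γ.Adj v u) (k : G v) (g : G u) :
    Commute (phiF Γ G v A v k) (phiF Γ G v A u g) := by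
  by_cases hu : u ∈ A
  · rw [phiF_self, phiF_mem Γ G v A h.ne' hu]
    simp only [MonoidHom.comp_apply]
    have e : (GraphProduct.of Γ G u g) • ((1 : GraphProduct Γ G) : Idx Γ G v A) =
        ((1 : GraphProduct Γ G) : Idx Γ G v A) := by
      change ((GraphProduct.of Γ G u g * 1 : GraphProduct Γ G) : Idx Γ G v A) = _
      rw [mul_one, QuotientGroup.eq]
      simpa using of_mem Γ G (A := {u | Γ.Adj v u ∧ u ∈ A}) ⟨h, hu⟩ g
    apply SemidirectProduct.ext
    · simp [e]
    · simp
  · rw [phiF_not_mem Γ G v A h.ne' hu]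
    exact Commute.one_right _

theorem phiF_comm {a b : V} (hab : Γ.Adj a b) (g : G a) (h : G b) :
    Commute (phiF Γ G v A a g) (phiF Γ G v A b h) := by
  by_cases ha : a = v
  · subst ha; exact phiF_comm_aux Γ G a A hab g h
  by_cases hb : b = v
  · subst hb; exact (phiF_comm_aux Γ G b A hab.symm h g).symm
  by_cases hA : a ∈ A
  · by_cases hB : b ∈ A
    · rw [phiF_mem Γ G v A ha hA, phiF_mem Γ G v A hb hB]
      have := (of_commute Γ G hab g h).eq
      simp only [MonoidHom.comp_apply]
      unfold Commute SemiconjBy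
      rw [← map_mul, this, map_mul]
    · rw [phiF_not_mem Γ G v A hb hB, MonoidHom.one_apply]
      exact Commute.one_right _
  · rw [phiF_not_mem Γ G v A ha hA, MonoidHom.one_apply]
    exact Commute.one_left _

/-- The map from the graph product to the semidirect product. -/
noncomputable def phi : GraphProduct Γ G →* SD Γ G v A :=
  liftGP (phiF Γ G v A) (fun _ _ hab g h => phiF_comm Γ G v A hab g h)

theorem psi_phi (hv : v ∉ A) {x : GraphProduct Γ G}
    (hx : x ∈ GraphProduct.vsub Γ G (insert v A)) : psi Γ G v A (phi Γ G v A x) = x := by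
  have : GraphProduct.vsub Γ G (insert v A) ≤
      ((psi Γ G v A).comp (phi Γ G v A)).eqLocus (MonoidHom.id _) := by
    refine vsub_le fun a ha g => ?_
    change psi Γ G v A (phi Γ G v A (GraphProduct.of Γ G a g)) = GraphProduct.of Γ G a g
    rw [phi, liftGP_of]
    by_cases h : a = v
    · subst h
      rw [phiF_self, MonoidHom.comp_apply, psi, SemidirectProduct.lift_inl, psiN_of]
      simp
    · rw [phiF_mem Γ G v A h (ha.resolve_left h), MonoidHom.comp_apply, psi,
        SemidirectProduct.lift_inr]
      rfl
  exact this hx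

theorem phi_right_mem (x : GraphProduct Γ G) :
    (phi Γ G v A x).right ∈ GraphProduct.vsub Γ G A := by
  refine gen_top Γ G (S := (GraphProduct.vsub Γ G A).comap
    (SemidirectProduct.rightHom.comp (phi Γ G v A))) (fun a g => ?_) x
  change (phi Γ G v A (GraphProduct.of Γ G a g)).right ∈ GraphProduct.vsub Γ G A
  rw [phi, liftGP_of]
  by_cases h : a = v
  · subst h
    rw [phiF_self]
    exact Subgroup.one_mem _
  · by_cases ha : a ∈ A
    · rw [phiF_mem Γ G v A h ha]
      exact of_mem Γ G ha g
    · rw [phiF_not_mem Γ G v A h ha]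
      exact Subgroup.one_mem _

/-- One-step splitting of finite subgroups. -/
theorem split_step (hv : v ∉ A) (F : Subgroup (GraphProduct Γ G)) [Finite F]
    (hF : F ≤ GraphProduct.vsub Γ G (insert v A)) :
    ∃ y : GraphProduct Γ G, (∀ f ∈ F, y⁻¹ * f * y ∈ GraphProduct.vsub Γ G A) ∨
      (∀ f ∈ F, ∃ k : G v, ∃ l ∈ Lk Γ G v A, y⁻¹ * f * y = GraphProduct.of Γ G v k * l) := by
  have : Finite (F.map (phi Γ G v A)) :=
    Set.Finite.to_subtype ((Set.toFinite (F : Set (GraphProduct Γ G))).image (phi Γ G v A))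
  obtain ⟨m, h | ⟨i, h⟩⟩ := fixed_point (GraphProduct Γ G) (F.map (phi Γ G v A))
  · refine ⟨psi Γ G v A (SemidirectProduct.inl m), Or.inl fun f hf => ?_⟩
    have h1 := h _ (Subgroup.mem_map_of_mem _ hf)
    have e : phi Γ G v A f * SemidirectProduct.inl m =
        SemidirectProduct.inl m * SemidirectProduct.inr (phi Γ G v A f).right := by
      apply SemidirectProduct.ext
      · simpa using h1
      · simp
    have e2 := congrArg (psi Γ G v A) e
    rw [map_mul, map_mul, psi_phi Γ G v A hv (hF hf)] at e2
    rw [mul_assoc, e2, inv_mul_cancel_left, psi, SemidirectProduct.lift_inr]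
    exact phi_right_mem Γ G v A f
  · obtain ⟨a, rfl⟩ := QuotientGroup.mk_surjective i
    refine ⟨psi Γ G v A (SemidirectProduct.inl m) * a, Or.inr fun f hf => ?_⟩
    obtain ⟨hs, k, hk⟩ := h _ (Subgroup.mem_map_of_mem _ hf)
    have e : phi Γ G v A f * SemidirectProduct.inl m =
        SemidirectProduct.inl m * (SemidirectProduct.inl (ofI (a : Idx Γ G v A) k) *
          SemidirectProduct.inr (phi Γ G v A f).right) := by
      apply SemidirectProduct.ext
      · simpa using hk
      · simp
    have e2 := congrArg (psi Γ G v A) e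
    rw [map_mul, map_mul, psi_phi Γ G v A hv (hF hf)] at e2
    set r := (phi Γ G v A f).right with hr
    have e3 : psi Γ G v A (SemidirectProduct.inl (ofI (a : Idx Γ G v A) k) *
          SemidirectProduct.inr r) = a * GraphProduct.of Γ G v k * a⁻¹ * r := by
      rw [map_mul, psi, SemidirectProduct.lift_inr, SemidirectProduct.lift_inl, psiN_of]
      rfl
    rw [e3] at e2
    have hl : a⁻¹ * r * a ∈ Lk Γ G v A := by
      have hs' : ((a : GraphProduct Γ G) : Idx Γ G v A) =
        ((r * a : GraphProduct Γ G) : Idx Γ G v A) := hs.symm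
      rw [QuotientGroup.eq] at hs'
      simpa [mul_assoc] using hs'
    refine ⟨k, _, hl, ?_⟩
    generalize psi Γ G v A (SemidirectProduct.inl m) = y at e2
    have : (y * a)⁻¹ * f * (y * a) = a⁻¹ * y⁻¹ * (f * y) * a := by group
    rw [this, e2]
    group

end Tree

/-- Every finite subgroup of `G(A)` is conjugate into `G(C)` for some complete `C ⊆ A`. -/
theorem finite_conj (n : ℕ) : ∀ (A : Finset V), A.card = n →
    ∀ F : Subgroup (GraphProduct Γ G), Finite F → F ≤ GraphProduct.vsub Γ G (A : Set V) →
    ∃ C : Set V, C ⊆ A ∧ Γ.IsClique C ∧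
      ∃ y, ∀ f ∈ F, y⁻¹ * f * y ∈ GraphProduct.vsub Γ G C := by
  classical
  induction n using Nat.strong_induction_on with
  | _ n ih =>
  intro A hA F hfin hF
  rcases A.eq_empty_or_nonempty with rfl | ⟨v, hvA⟩
  · exact ⟨∅, by simp, by simp, 1, fun f hf => by simpa using hF hf⟩
  have hAe : (A : Set V) = insert v ((A.erase v : Finset V) : Set V) := by
    rw [← Finset.coe_insert, Finset.insert_erase hvA]
  have hcard : (A.erase v).card < n := hA ▸ Finset.card_erase_lt_of_mem hvA
  have hv : v ∉ ((A.erase v : Finset V) : Set V) := by simp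
  rw [hAe] at hF
  obtain ⟨y, h | h⟩ := split_step Γ G v _ hv F hF
  · have hfin' : Finite (F.map (MulAut.conj y⁻¹).toMonoidHom) :=
      Set.Finite.to_subtype ((Set.toFinite (F : Set (GraphProduct Γ G))).image _)
    obtain ⟨C, hCA, hC, z, hz⟩ := ih _ hcard (A.erase v) rfl
      (F.map (MulAut.conj y⁻¹).toMonoidHom) hfin' (by
        rintro _ ⟨f, hf, rfl⟩
        simpa using h f hf)
    refine ⟨C, hCA.trans (by exact_mod_cast Finset.erase_subset v A), hC, y * z, fun f hf => ?_⟩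
    have := hz _ (Subgroup.mem_map_of_mem _ hf)
    simpa [mul_assoc] using this
  · let B : Finset V := (A.erase v).filter fun u => Γ.Adj v u
    have hB : {u | Γ.Adj v u ∧ u ∈ ((A.erase v : Finset V) : Set V)} = (B : Set V) := by
      ext u; simp [B, and_comm]
    have hBc : B.card < n := lt_of_le_of_lt (Finset.card_filter_le _ _) hcard
    have hcomm : ∀ x ∈ GraphProduct.vsub Γ G (B : Set V), ∀ k, Commute x
        (GraphProduct.of Γ G v k) := by
      intro x hx k
      rw [← hB] at hx
      exact lk_commute Γ G v _ hx k
    simp only [Lk, hB] at h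
    have hvB : v ∉ (B : Set V) := by simp [B]
    have hfin' : Finite (F.map ((retr Γ G B).comp (MulAut.conj y⁻¹).toMonoidHom)) :=
      Set.Finite.to_subtype ((Set.toFinite (F : Set (GraphProduct Γ G))).image _)
    obtain ⟨C, hCB, hC, z, hz⟩ := ih _ hBc B rfl
      (F.map ((retr Γ G B).comp (MulAut.conj y⁻¹).toMonoidHom)) hfin' (by
        rintro _ ⟨f, hf, rfl⟩
        exact retr_mem Γ G _ _)
    refine ⟨insert v C, ?_, ?_, y * retr Γ G B z, fun f hf => ?_⟩
    · rintro u (rfl | hu)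
      · exact hvA
      · have := hCB hu
        simp [B] at this
        exact this.1.2
    · rw [SimpleGraph.isClique_insert]
      refine ⟨hC, fun b hb _ => ?_⟩
      have := hCB hb
      simp [B] at this
      exact this.2
    · obtain ⟨k, l, hl, e⟩ := h f hf
      have h1 := hz _ (Subgroup.mem_map_of_mem _ hf)
      have h2 : ((retr Γ G B).comp (MulAut.conj y⁻¹).toMonoidHom) f = l := by
        simp only [MonoidHom.comp_apply, MulEquiv.coe_toMonoidHom, MulAut.conj_apply, inv_inv]
        rw [e, map_mul, retr_of_not_mem Γ G hvB, one_mul, retr_eq Γ G hl]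
      rw [h2] at h1
      have h3 := retr_eq Γ G (vsub_mono Γ G hCB h1)
      rw [map_mul, map_mul, map_inv, retr_eq Γ G hl] at h3
      rw [← h3] at h1
      have hc := (hcomm _ (retr_mem Γ G B z) k).eq
      generalize retr Γ G B z = z' at *
      have e4 : (y * z')⁻¹ * f * (y * z') = GraphProduct.of Γ G v k * (z'⁻¹ * l * z') := by
        calc (y * z')⁻¹ * f * (y * z') = z'⁻¹ * (y⁻¹ * f * y) * z' := by group
          _ = z'⁻¹ * (GraphProduct.of Γ G v k * z') * (z'⁻¹ * l * z') := by rw [e]; group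
          _ = _ := by rw [← hc]; group
      rw [e4]
      exact Subgroup.mul_mem _ (of_mem Γ G (Set.mem_insert _ _) k)
        (vsub_mono Γ G (Set.subset_insert _ _) h1)

theorem exists_max_clique [Fintype V] {C : Set V} (hC : Γ.IsClique C) :
    ∃ D, C ⊆ D ∧ IsMaxClique Γ D := by
  obtain ⟨D, hCD, hD⟩ := (Set.toFinite {D : Set V | Γ.IsClique D}).exists_le_maximal hC
  exact ⟨D, hCD, hD.1, fun E hE hDE => le_antisymm hDE (hD.2 hE hDE)⟩

theorem finite_le [Fintype V] (F : Subgroup (GraphProduct Γ G)) (hF : Finite F) :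
    ∃ D, IsMaxClique Γ D ∧ ∃ g : GraphProduct Γ G,
      F ≤ (GraphProduct.vsub Γ G D).map (MulAut.conj g).toMonoidHom := by
  obtain ⟨C, -, hC, y, hy⟩ := finite_conj Γ G _ Finset.univ rfl F hF
    (fun x _ => gen_top Γ G (fun a g => of_mem Γ G (by simp) g) x)
  obtain ⟨D, hCD, hD⟩ := exists_max_clique Γ hC
  refine ⟨D, hD, y, fun f hf => ⟨y⁻¹ * f * y, vsub_mono Γ G hCD (hy f hf), ?_⟩⟩
  simp [mul_assoc]

theorem finite_conj_vsub [Fintype V] [∀ v, Finite (G v)] {C : Set V} (hC : Γ.IsClique C)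
    (g : GraphProduct Γ G) :
    Finite ((GraphProduct.vsub Γ G C).map (MulAut.conj g).toMonoidHom) := by
  have := finite_vsub Γ G hC
  exact Set.Finite.to_subtype
    ((Set.toFinite (GraphProduct.vsub Γ G C : Set (GraphProduct Γ G))).image _)

theorem subset_of_le [∀ v, Nontrivial (G v)] {C D : Set V} {g h : GraphProduct Γ G}
    (hle : (GraphProduct.vsub Γ G C).map (MulAut.conj g).toMonoidHom ≤
      (GraphProduct.vsub Γ G D).map (MulAut.conj h).toMonoidHom) : C ⊆ D := by
  intro v hv
  by_contra hvD
  obtain ⟨k, hk⟩ := exists_ne (1 : G v)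
  have hD : GraphProduct.vsub Γ G D ≤ (proj Γ G v).ker :=
    vsub_le fun a ha x => proj_ne Γ G (fun e : a = v => hvD (e ▸ ha)) x
  obtain ⟨x, hx, e⟩ := hle (Subgroup.mem_map_of_mem _ (of_mem Γ G hv k))
  have e2 := congrArg (proj Γ G v) e
  have hx' : proj Γ G v x = 1 := hD hx
  simp only [MulEquiv.coe_toMonoidHom, MulAut.conj_apply, map_mul, map_inv, hx', proj_same] at e2
  rw [mul_one, mul_inv_cancel, eq_comm, mul_inv_eq_one, mul_eq_left] at e2
  exact hk e2

end GP

end GPAux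

/-- If the vertex groups are nontrivial and finite, then a subgroup `F` of `G`
is a maximal finite subgroup if and only if `F` is a conjugate of `G(C)` for some clique `C`. -/
theorem graphProduct_maximal_finite_subgroup_iff {V : Type*} [Fintype V] (Γ : SimpleGraph V)
    (G : V → Type*) [∀ v, Group (G v)] [∀ v, Finite (G v)] [∀ v, Nontrivial (G v)]
    (F : Subgroup (GraphProduct Γ G)) :
    (Finite F ∧ ∀ F' : Subgroup (GraphProduct Γ G), Finite F' → F ≤ F' → F = F') ↔
    (∃ C : Set V, IsMaxClique Γ C ∧ ∃ g : GraphProduct Γ G,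
      F = (GraphProduct.vsub Γ G C).map (MulAut.conj g).toMonoidHom) := by
  constructor
  · rintro ⟨hF, hmax⟩
    obtain ⟨D, hD, g, hle⟩ := GPAux.finite_le Γ G F hF
    exact ⟨D, hD, g, hmax _ (GPAux.finite_conj_vsub Γ G hD.1 g) hle⟩
  · rintro ⟨C, hC, g, rfl⟩
    refine ⟨GPAux.finite_conj_vsub Γ G hC.1 g, fun F' hF' hle => ?_⟩
    obtain ⟨D, hD, h, hle'⟩ := GPAux.finite_le Γ G F' hF'
    have hCD := hC.2 D hD.1 (GPAux.subset_of_le Γ G (hle.trans hle'))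
    subst hCD
    have := GPAux.finite_conj_vsub Γ G hC.1 h
    have heq := Subgroup.eq_of_le_of_card_ge (hle.trans hle') (by
      rw [Subgroup.card_map_of_injective (MulEquiv.injective _),
        Subgroup.card_map_of_injective (MulEquiv.injective _)])
    exact le_antisymm hle (hle'.trans heq.ge)
end

section
/- Let Γ = (V,E) and Γ' = (V',E') be finite simple graphs satisfying the T₁ condition, with families of nontrivial finite vertex groups (G_v)_{v∈V} and (G'_{v'})_{v'∈V'}. If the graph product of (Γ, G_v) is isomorphic as a group to the graph product of (Γ', G'_{v'}), then there exists a graph isomorphism ψ : Γ → Γ' such that G_v is isomorphic to G'_{ψ(v)} for every v ∈ V. -/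
open Monoid

section FP
variable {X A : Type*} [Group A]

/-- free product of copies of `A` -/
abbrev FP (X A : Type*) [Group A] := CoprodI (fun _ : X => A)

/-- inclusion of the `i`-th copy -/
def ofi (i : X) : A →* FP X A := CoprodI.of (M := fun _ : X => A) (i := i)

open Classical in
/-- syllable length -/
noncomputable def clen (x : FP X A) : ℕ := (CoprodI.Word.equiv x).toList.length

theorem clen_one : clen (1 : FP X A) = 0 := by
  classical
  have : CoprodI.Word.equiv (1 : FP X A) = CoprodI.Word.empty := by
    exact CoprodI.Word.equiv.apply_symm_apply (CoprodI.Word.empty : CoprodI.Word (fun _ : X => A))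
  exact (congrArg (fun w : CoprodI.Word (fun _ : X => A) => w.toList.length) this :)

theorem clen_prod {i j : X} (w : CoprodI.NeWord (fun _ : X => A) i j) :
    clen w.prod = w.toList.length := by
  classical
  have : CoprodI.Word.equiv w.prod = w.toWord := CoprodI.Word.equiv.apply_symm_apply _
  exact (congrArg (fun w : CoprodI.Word (fun _ : X => A) => w.toList.length) this :)

theorem fp_cases (x : FP X A) :
    x = 1 ∨ ∃ (i j : X) (w : CoprodI.NeWord (fun _ : X => A) i j), x = w.prod := by
  classical
  by_cases h : CoprodI.Word.equiv x = CoprodI.Word.empty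
  · left
    have := CoprodI.Word.equiv.symm_apply_apply x
    rw [h] at this
    rw [← this]; exact CoprodI.Word.prod_empty
  · right
    obtain ⟨i, j, w, hw⟩ := CoprodI.NeWord.of_word _ h
    refine ⟨i, j, w, ?_⟩
    have := CoprodI.Word.equiv.symm_apply_apply x
    rw [← hw] at this
    exact this.symm

theorem neword_pos {i j : X} (w : CoprodI.NeWord (fun _ : X => A) i j) : 1 ≤ w.toList.length :=
  List.length_pos_iff.2 w.toList_ne_nil

/-- midpoint lemma -/
theorem fp_mid (y y' : FP X A) :
    y = y' ∨ (∃ (i : X) (a : A), a ≠ 1 ∧ y⁻¹ * y' = ofi i a) ∨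
    ∃ z : FP X A, ∀ o, clen (z⁻¹ * o) + 1 ≤ max (clen (y⁻¹ * o)) (clen (y'⁻¹ * o)) := by
  rcases fp_cases (y⁻¹ * y') with h | ⟨i, j, w, h⟩
  · left; exact (inv_mul_eq_one.1 h)
  right
  cases w with
  | singleton a ha => left; exact ⟨i, a, ha, by rw [h, CoprodI.NeWord.prod_singleton]; rfl⟩
  | @append _ j k _ w₁ hne w₂ =>
    right
    refine ⟨y * w₁.prod, fun o => ?_⟩
    rw [CoprodI.NeWord.append_prod] at h
    have hy' : y' = y * (w₁.prod * w₂.prod) := by rw [← h]; group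
    generalize hx : (y * w₁.prod)⁻¹ * o = x
    have h1 : y⁻¹ * o = w₁.prod * x := by rw [← hx]; group
    have h2 : y'⁻¹ * o = w₂.inv.prod * x := by
      rw [← hx, hy', CoprodI.NeWord.inv_prod]; group
    rw [h1, h2]
    rcases fp_cases x with rfl | ⟨p, q, u, rfl⟩
    · rw [mul_one, clen_one, clen_prod]
      have := neword_pos w₁
      omega
    · by_cases hp : j = p
      · subst hp
        have : w₂.inv.prod * u.prod = (CoprodI.NeWord.append w₂.inv hne.symm u).prod := by simp
        rw [this, clen_prod, clen_prod]
        have := neword_pos w₂.inv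
        simp only [CoprodI.NeWord.toList, List.length_append]
        omega
      · have : w₁.prod * u.prod = (CoprodI.NeWord.append w₁ hp u).prod := by simp
        rw [this, clen_prod u, clen_prod]
        have := neword_pos w₁
        simp only [CoprodI.NeWord.toList, List.length_append]
        omega

theorem ofi_eq {i j : X} {a b : A} (ha : a ≠ 1) (h : ofi i a = ofi j b) : i = j := by
  classical
  by_contra hij
  have := congrArg (CoprodI.lift (fun k : X => if k = i then MonoidHom.id A else 1)) h
  simp [ofi, Ne.symm hij] at this
  exact ha this

variable {Q : Type*} [Group Q] [MulAction Q X]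

/-- permutation of the copies -/
def permHom (q : Q) : FP X A →* FP X A := CoprodI.lift (fun i => ofi (q • i))

theorem permHom_ofi (q : Q) (i : X) (a : A) : permHom q (ofi i a) = ofi (q • i) a :=
  CoprodI.lift_of _ _

theorem fp_hom_ext {N : Type*} [Monoid N] {f g : FP X A →* N} (h : ∀ i a, f (ofi i a) = g (ofi i a)) :
    f = g :=
  CoprodI.ext_hom _ _ fun i => MonoidHom.ext fun a => h i a

theorem permHom_mul (q r : Q) : (permHom (q * r) : FP X A →* FP X A) = (permHom q).comp (permHom r) :=
  fp_hom_ext fun i a => by simp [permHom_ofi, mul_smul]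

theorem permHom_one : (permHom (1 : Q) : FP X A →* FP X A) = MonoidHom.id _ :=
  fp_hom_ext fun i a => by simp [permHom_ofi]

/-- the permutation action as a hom to automorphisms -/
def permAut (X A : Type*) [Group A] (Q : Type*) [Group Q] [MulAction Q X] : Q →* MulAut (FP X A) where
  toFun q := (permHom q).toMulEquiv (permHom q⁻¹)
    (by rw [← permHom_mul, inv_mul_cancel, permHom_one])
    (by rw [← permHom_mul, mul_inv_cancel, permHom_one])
  map_one' := by ext x; exact DFunLike.congr_fun permHom_one x
  map_mul' q r := by ext x; exact DFunLike.congr_fun (permHom_mul q r) x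

theorem permAut_ofi (q : Q) (i : X) (a : A) : permAut X A Q q (ofi i a) = ofi (q • i) a :=
  permHom_ofi q i a

theorem permAut_neword (q : Q) {i j : X} (w : CoprodI.NeWord (fun _ : X => A) i j) :
    ∃ w' : CoprodI.NeWord (fun _ : X => A) (q • i) (q • j),
      permAut X A Q q w.prod = w'.prod ∧ w'.toList.length = w.toList.length := by
  induction w with
  | singleton x hx =>
    refine ⟨.singleton x hx, ?_, rfl⟩
    rw [CoprodI.NeWord.prod_singleton, CoprodI.NeWord.prod_singleton]
    exact permAut_ofi q _ _
  | append w₁ hne w₂ ih1 ih2 =>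
    obtain ⟨a, ha, ha'⟩ := ih1
    obtain ⟨b, hb, hb'⟩ := ih2
    refine ⟨.append a (fun h => hne (MulAction.injective q h)) b, ?_, ?_⟩
    · rw [CoprodI.NeWord.append_prod, CoprodI.NeWord.append_prod, map_mul, ha, hb]
    · simp [ha', hb']

theorem clen_permAut (q : Q) (x : FP X A) : clen (permAut X A Q q x) = clen x := by
  rcases fp_cases x with rfl | ⟨i, j, w, rfl⟩
  · rw [map_one]
  · obtain ⟨w', h, h'⟩ := permAut_neword q w
    rw [h, clen_prod, clen_prod, h']

open SemidirectProduct in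
theorem fp_fixed (H : Subgroup (FP X A ⋊[permAut X A Q] Q)) [Finite H] :
    (∃ x : FP X A, ∀ h ∈ H, ∃ q : Q, h * inl x = inl x * inr q) ∨
    (∃ (x : FP X A) (i : X), ∀ h ∈ H, ∃ (a : A) (q : Q), q • i = i ∧
      h * inl x = inl x * (inl (ofi i a) * inr q)) := by
  classical
  have := Fintype.ofFinite H
  let R : FP X A → ℕ := fun y => Finset.univ.sup (fun h : H => clen (y⁻¹ * h.1.left))
  let act : (FP X A ⋊[permAut X A Q] Q) → FP X A → FP X A := fun h y => h.left * permAut X A Q h.right y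
  have hmul : ∀ h (y : FP X A), h * inl y = inl (act h y) * inr h.right := by
    intro h y; ext <;> simp [act]
  have hact : ∀ h y y', (act h y)⁻¹ * act h y' = permAut X A Q h.right (y⁻¹ * y') := by
    intro h y y'; simp [act]
  have hR : ∀ h ∈ H, ∀ y, R (act h y) ≤ R y := by
    intro h hh y
    refine Finset.sup_le fun k _ => ?_
    have e : k.1.left = act h (h⁻¹ * k.1).left := by simp [act]
    rw [e, hact, clen_permAut]
    exact Finset.le_sup (f := fun h : H => clen (y⁻¹ * h.1.left))
      (Finset.mem_univ (⟨h⁻¹ * k.1, H.mul_mem (H.inv_mem hh) k.2⟩ : H))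
  obtain ⟨y0, hy0⟩ : ∃ y0, ∀ y, R y0 ≤ R y :=
    ⟨Function.argmin R, fun y => Function.argmin_le R y⟩
  have key : ∀ y y', R y ≤ R y0 → R y' ≤ R y0 → y ≠ y' →
      ∃ (i : X) (a : A), a ≠ 1 ∧ y⁻¹ * y' = ofi i a := by
    intro y y' h h' hne
    rcases fp_mid y y' with h1 | h1 | ⟨z, hz⟩
    · exact absurd h1 hne
    · exact h1
    · exfalso
      have h2 := hy0 z
      have : R z < R y0 := by
        obtain ⟨k, -, hk⟩ := Finset.exists_mem_eq_sup (Finset.univ : Finset H) ⟨1, Finset.mem_univ _⟩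
          (fun h : H => clen (z⁻¹ * h.1.left))
        have e1 : R z = clen (z⁻¹ * k.1.left) := hk
        have e2 : clen (y⁻¹ * k.1.left) ≤ R y :=
          Finset.le_sup (f := fun h : H => clen (y⁻¹ * h.1.left)) (Finset.mem_univ k)
        have e3 : clen (y'⁻¹ * k.1.left) ≤ R y' :=
          Finset.le_sup (f := fun h : H => clen (y'⁻¹ * h.1.left)) (Finset.mem_univ k)
        have := hz k.1.left
        omega
      omega
  by_cases hu : ∀ y, R y ≤ R y0 → y = y0
  · left
    refine ⟨y0, fun h hh => ⟨h.right, ?_⟩⟩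
    rw [hmul, hu _ (hR h hh y0)]
  · right
    push Not at hu
    obtain ⟨y1, hy1, hne⟩ := hu
    obtain ⟨i, a, ha, hia⟩ := key y0 y1 le_rfl hy1 hne.symm
    have key2 : ∀ y, R y ≤ R y0 → ∃ b, y = y0 * ofi i b := by
      intro y hy
      by_cases e0 : y0 = y
      · exact ⟨1, by simp [e0]⟩
      by_cases e1 : y1 = y
      · exact ⟨a, by rw [← hia]; simp [e1]⟩
      obtain ⟨j, b, hb, hjb⟩ := key y0 y le_rfl hy e0
      obtain ⟨k, c, hc, hkc⟩ := key y1 y hy1 hy e1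
      have e : ofi i a * ofi k c = ofi j b := by rw [← hia, ← hjb, ← hkc]; group
      have : i = j := by
        by_contra hij
        have := congrArg (CoprodI.lift (fun l : X => if l = i then MonoidHom.id A else 1)) e
        have h' := congrArg (CoprodI.lift (fun l : X => if l = j then MonoidHom.id A else 1)) e
        simp only [ofi, map_mul, CoprodI.lift_of, if_neg (Ne.symm hij), if_neg hij, if_true] at this h'
        by_cases hk : k = i
        · subst hk
          simp [hij] at h'
          exact hb h'.symm
        · simp [hk] at this
          exact ha this
      subst this
      exact ⟨b, by rw [← hjb]; group⟩
    refine ⟨y0, i, fun h hh => ?_⟩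
    obtain ⟨b, hb⟩ := key2 _ (hR h hh y0)
    obtain ⟨c, hc⟩ := key2 _ ((hR h hh y1).trans hy1)
    refine ⟨b, h.right, ?_, ?_⟩
    · have e := hact h y0 y1
      rw [hia, permAut_ofi, hb, hc] at e
      refine ofi_eq (b := b⁻¹ * c) ha ?_
      rw [← e, map_mul, map_inv]; group
    · rw [hmul, hb, map_mul, mul_assoc]
end FP
section GP
variable {V : Type*} {Γ : SimpleGraph V} {G : V → Type*} [∀ v, Group (G v)]

namespace GP

/-- universal property of the graph product -/
def lift {N : Type*} [Group N] (f : ∀ v, G v →* N)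
    (hf : ∀ u v, Γ.Adj u v → ∀ g h, Commute (f u g) (f v h)) : GraphProduct Γ G →* N :=
  QuotientGroup.lift _ (CoprodI.lift f) (by
    apply Subgroup.normalClosure_le_normal
    rintro x ⟨u, v, h, a, b, rfl⟩
    have := hf u v h a b
    simp only [SetLike.mem_coe, MonoidHom.mem_ker, map_mul, map_inv, CoprodI.lift_of]
    rw [mul_assoc, this.eq]
    group)

theorem lift_of {N : Type*} [Group N] (f : ∀ v, G v →* N)
    (hf : ∀ u v, Γ.Adj u v → ∀ g h, Commute (f u g) (f v h)) (v : V) (a : G v) :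
    lift f hf (GraphProduct.of Γ G v a) = f v a := by
  change CoprodI.lift f (CoprodI.of a) = _
  simp

theorem hom_ext {N : Type*} [Group N] {f g : GraphProduct Γ G →* N}
    (h : ∀ v a, f (GraphProduct.of Γ G v a) = g (GraphProduct.of Γ G v a)) : f = g := by
  refine QuotientGroup.monoidHom_ext _ (CoprodI.ext_hom _ _ fun i => MonoidHom.ext fun a => h i a)

theorem of_comm {u v : V} (h : Γ.Adj u v) (a : G u) (b : G v) :
    Commute (GraphProduct.of Γ G u a) (GraphProduct.of Γ G v b) := by
  have h1 : (CoprodI.of a)⁻¹ * (CoprodI.of b)⁻¹ * CoprodI.of a * CoprodI.of b ∈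
      Subgroup.normalClosure (graphProdRels Γ G) :=
    Subgroup.subset_normalClosure ⟨u, v, h, a, b, rfl⟩
  have h2 : (GraphProduct.of Γ G u a)⁻¹ * (GraphProduct.of Γ G v b)⁻¹ *
    GraphProduct.of Γ G u a * GraphProduct.of Γ G v b = 1 :=
    (QuotientGroup.eq_one_iff _).2 h1
  have h3 : (GraphProduct.of Γ G v b * GraphProduct.of Γ G u a)⁻¹ *
    (GraphProduct.of Γ G u a * GraphProduct.of Γ G v b) = 1 := by rw [← h2]; group
  exact (inv_mul_eq_one.1 h3).symm

theorem of_mem {A : Set V} {v : V} (hv : v ∈ A) (a : G v) :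
    GraphProduct.of Γ G v a ∈ GraphProduct.vsub Γ G A :=
  (le_iSup₂ (f := fun a (_ : a ∈ A) => (GraphProduct.of Γ G a).range) v hv) ⟨a, rfl⟩

theorem vsub_le {A : Set V} {S : Subgroup (GraphProduct Γ G)}
    (h : ∀ v ∈ A, ∀ a, GraphProduct.of Γ G v a ∈ S) : GraphProduct.vsub Γ G A ≤ S := by
  refine iSup₂_le fun v hv => ?_
  rintro _ ⟨a, rfl⟩
  exact h v hv a

theorem vsub_mono {A B : Set V} (h : A ⊆ B) :
    GraphProduct.vsub Γ G A ≤ GraphProduct.vsub Γ G B :=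
  vsub_le fun _ hv _ => of_mem (h hv) _


theorem mem_univ (x : GraphProduct Γ G) : x ∈ GraphProduct.vsub Γ G Set.univ := by
  obtain ⟨y, rfl⟩ := QuotientGroup.mk'_surjective _ x
  induction y using CoprodI.induction_on with
  | one => rw [map_one]; exact one_mem _
  | of v a => exact of_mem (Γ := Γ) (Set.mem_univ v) a
  | mul a b ha hb => rw [map_mul]; exact mul_mem ha hb

open Classical in
/-- retraction onto the subgroup generated by `A` -/
noncomputable def ret (A : Set V) : GraphProduct Γ G →* GraphProduct Γ G :=
  lift (fun u => if u ∈ A then GraphProduct.of Γ G u else 1) (fun u v h a b => by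
    split_ifs
    · exact of_comm h a b
    · exact Commute.one_right _
    · exact Commute.one_left _
    · exact Commute.one_left _)

theorem ret_of_mem {A : Set V} {u : V} (hu : u ∈ A) (a : G u) :
    ret A (GraphProduct.of Γ G u a) = GraphProduct.of Γ G u a := by
  simp [ret, lift_of, hu]

theorem ret_of_not_mem {A : Set V} {u : V} (hu : u ∉ A) (a : G u) :
    ret A (GraphProduct.of Γ G u a) = 1 := by
  simp [ret, lift_of, hu]

theorem ret_eq {A : Set V} {x : GraphProduct Γ G} (hx : x ∈ GraphProduct.vsub Γ G A) :
    ret A x = x := by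
  have : GraphProduct.vsub Γ G A ≤ (ret A).eqLocus (MonoidHom.id _) :=
    vsub_le fun v hv a => ret_of_mem hv a
  exact this hx

theorem ret_mem {A B : Set V} {x : GraphProduct Γ G} (hx : x ∈ GraphProduct.vsub Γ G B) :
    ret A x ∈ GraphProduct.vsub Γ G (B ∩ A) := by
  have : GraphProduct.vsub Γ G B ≤ (GraphProduct.vsub Γ G (B ∩ A)).comap (ret A) := by
    refine vsub_le fun v hv a => ?_
    rw [Subgroup.mem_comap]
    by_cases h : v ∈ A
    · rw [ret_of_mem h]; exact of_mem (A := B ∩ A) (Set.mem_inter hv h) a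
    · rw [ret_of_not_mem h]; exact one_mem _
  exact this hx

theorem ret_mem' {A : Set V} (x : GraphProduct Γ G) : ret A x ∈ GraphProduct.vsub Γ G A := by
  simpa using ret_mem (A := A) (mem_univ x)

section split
variable (Γ G) (v : V)

/-- the index set of the free factors -/
abbrev Ix : Type _ := GraphProduct Γ G ⧸ GraphProduct.vsub Γ G (Γ.neighborSet v)

theorem psi_wd (k l : GraphProduct Γ G) (h : (k : Ix Γ G v) = l) (a : G v) :
    ret {v}ᶜ k * GraphProduct.of Γ G v a * (ret {v}ᶜ k)⁻¹ =
      ret {v}ᶜ l * GraphProduct.of Γ G v a * (ret {v}ᶜ l)⁻¹ := by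
  rw [QuotientGroup.eq] at h
  have hc : ∀ x ∈ GraphProduct.vsub Γ G (Γ.neighborSet v), Commute x (GraphProduct.of Γ G v a) := by
    have : GraphProduct.vsub Γ G (Γ.neighborSet v) ≤
        Subgroup.centralizer {GraphProduct.of Γ G v a} := by
      refine vsub_le fun u hu b => ?_
      rw [Subgroup.mem_centralizer_singleton_iff]
      exact (of_comm hu a b).symm
    intro x hx
    exact Subgroup.mem_centralizer_singleton_iff.1 (this hx)
  have hr : ret {v}ᶜ (k⁻¹ * l) = k⁻¹ * l := by
    apply ret_eq
    refine vsub_mono ?_ h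
    intro u hu
    simp only [Set.mem_compl_iff, Set.mem_singleton_iff]
    rintro rfl
    exact Γ.irrefl hu
  have e : ret {v}ᶜ l = ret {v}ᶜ k * (k⁻¹ * l) := by rw [← hr]; simp
  rw [e, mul_assoc _ (k⁻¹ * l), (hc _ h).eq]
  group

/-- the map from the free product to the graph product -/
noncomputable def psi : FP (Ix Γ G v) (G v) →* GraphProduct Γ G :=
  CoprodI.lift fun i => (MulAut.conj (ret {v}ᶜ i.out)).toMonoidHom.comp (GraphProduct.of Γ G v)

theorem psi_ofi (k : GraphProduct Γ G) (a : G v) :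
    psi Γ G v (ofi (k : Ix Γ G v) a) =
      ret {v}ᶜ k * GraphProduct.of Γ G v a * (ret {v}ᶜ k)⁻¹ := by
  have : psi Γ G v (ofi (k : Ix Γ G v) a) =
      MulAut.conj (ret {v}ᶜ (k : Ix Γ G v).out) (GraphProduct.of Γ G v a) := CoprodI.lift_of _ _
  rw [this, MulAut.conj_apply]
  exact psi_wd Γ G v _ _ (Quotient.out_eq _) a

/-- the map from the semidirect product to the graph product -/
noncomputable def psit :
    FP (Ix Γ G v) (G v) ⋊[permAut (Ix Γ G v) (G v) (GraphProduct Γ G)] GraphProduct Γ G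
      →* GraphProduct Γ G :=
  SemidirectProduct.lift (psi Γ G v) (ret {v}ᶜ) fun q => fp_hom_ext fun i a => by
    induction i using QuotientGroup.induction_on with
    | H k =>
      simp only [MonoidHom.comp_apply, MulEquiv.coe_toMonoidHom, permAut_ofi, MulAut.conj_apply]
      change psi Γ G v (ofi ((q * k : GraphProduct Γ G) : Ix Γ G v) a) = _
      rw [psi_ofi, psi_ofi, map_mul]
      group

theorem phi_comm (w : V) (h : Γ.Adj v w) (a : G v) (b : G w) :
    Commute (SemidirectProduct.inl (ofi ((1 : GraphProduct Γ G) : Ix Γ G v) a) :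
      FP (Ix Γ G v) (G v) ⋊[permAut (Ix Γ G v) (G v) (GraphProduct Γ G)] GraphProduct Γ G)
      (SemidirectProduct.inr (GraphProduct.of Γ G w b)) := by
  have h1 := SemidirectProduct.inl_aut (φ := permAut (Ix Γ G v) (G v) (GraphProduct Γ G))
    (GraphProduct.of Γ G w b) (ofi ((1 : GraphProduct Γ G) : Ix Γ G v) a)
  rw [permAut_ofi] at h1
  have h2 : (GraphProduct.of Γ G w b) • ((1 : GraphProduct Γ G) : Ix Γ G v) =
      ((1 : GraphProduct Γ G) : Ix Γ G v) := by
    change ((GraphProduct.of Γ G w b * 1 : GraphProduct Γ G) : Ix Γ G v) = _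
    rw [QuotientGroup.eq]
    simpa using of_mem (A := Γ.neighborSet v) h b
  rw [h2, map_inv] at h1
  exact eq_mul_inv_iff_mul_eq.1 h1

open Classical in
/-- the map from the graph product to the semidirect product, on vertex groups -/
noncomputable def phiv (u : V) : G u →*
    FP (Ix Γ G v) (G v) ⋊[permAut (Ix Γ G v) (G v) (GraphProduct Γ G)] GraphProduct Γ G :=
  if h : u = v then
      SemidirectProduct.inl.comp ((ofi ((1 : GraphProduct Γ G) : Ix Γ G v)).comp
        (MulEquiv.cast (M := G) h).toMonoidHom)
    else SemidirectProduct.inr.comp (GraphProduct.of Γ G u)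

theorem phiv_self (a : G v) : phiv Γ G v v a =
    SemidirectProduct.inl (ofi ((1 : GraphProduct Γ G) : Ix Γ G v) a) := by
  rw [phiv, dif_pos rfl]; rfl

theorem phiv_ne {u : V} (h : u ≠ v) (a : G u) : phiv Γ G v u a =
    SemidirectProduct.inr (GraphProduct.of Γ G u a) := by
  rw [phiv, dif_neg h]; rfl

theorem phiv_comm (u w : V) (h : Γ.Adj u w) (a : G u) (b : G w) :
    Commute (phiv Γ G v u a) (phiv Γ G v w b) := by
  by_cases hu : u = v
  · subst hu
    rw [phiv_self, phiv_ne _ _ _ h.ne']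
    exact phi_comm Γ G u w h a b
  · by_cases hw : w = v
    · subst hw
      rw [phiv_self, phiv_ne _ _ _ h.ne]
      exact (phi_comm Γ G w u h.symm b a).symm
    · rw [phiv_ne _ _ _ hu, phiv_ne _ _ _ hw]
      exact (of_comm h a b).map SemidirectProduct.inr

/-- the map from the graph product to the semidirect product -/
noncomputable def phi : GraphProduct Γ G →*
    FP (Ix Γ G v) (G v) ⋊[permAut (Ix Γ G v) (G v) (GraphProduct Γ G)] GraphProduct Γ G :=
  lift (phiv Γ G v) (phiv_comm Γ G v)

theorem psit_phi (x : GraphProduct Γ G) : psit Γ G v (phi Γ G v x) = x := by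
  have : (psit Γ G v).comp (phi Γ G v) = MonoidHom.id _ := hom_ext fun u a => by
    rw [MonoidHom.comp_apply, phi, lift_of, MonoidHom.id_apply]
    by_cases h : u = v
    · subst h
      rw [phiv_self, psit, SemidirectProduct.lift_inl, psi_ofi]
      simp
    · rw [phiv_ne _ _ _ h, psit, SemidirectProduct.lift_inr]
      exact ret_of_mem (A := {v}ᶜ) (by simpa using h) a
  exact DFunLike.congr_fun this x

end split

/-- a finite group maps into a conjugate of one of the two factors -/
theorem split_finite (v : V) {H : Type*} [Group H] [Finite H] (f : H →* GraphProduct Γ G) :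
    (∃ g, ∀ h, g⁻¹ * f h * g ∈ GraphProduct.vsub Γ G {v}ᶜ) ∨
    (∃ g, ∀ h, g⁻¹ * f h * g ∈ GraphProduct.vsub Γ G (insert v (Γ.neighborSet v))) := by
  have : Finite ((phi Γ G v).comp f).range := Set.finite_range _
  have hf : ∀ h, f h = psit Γ G v (phi Γ G v (f h)) := fun h => (psit_phi Γ G v _).symm
  rcases fp_fixed ((phi Γ G v).comp f).range with ⟨x, hx⟩ | ⟨x, i, hx⟩
  · left
    refine ⟨psi Γ G v x, fun h => ?_⟩
    obtain ⟨q, hq⟩ := hx (phi Γ G v (f h)) ⟨h, rfl⟩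
    have := congrArg (psit Γ G v) hq
    rw [map_mul, ← hf] at this
    simp only [map_mul, psit, SemidirectProduct.lift_inl, SemidirectProduct.lift_inr] at this
    rw [mul_assoc, this, inv_mul_cancel_left]
    exact ret_mem' _
  · right
    induction i using QuotientGroup.induction_on with
    | H k =>
    refine ⟨psi Γ G v x * ret {v}ᶜ k, fun h => ?_⟩
    obtain ⟨a, q, hqi, hq⟩ := hx (phi Γ G v (f h)) ⟨h, rfl⟩
    have := congrArg (psit Γ G v) hq
    rw [map_mul, ← hf] at this
    simp only [map_mul, psit, SemidirectProduct.lift_inl, SemidirectProduct.lift_inr] at this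
    rw [psi_ofi] at this
    have h2 : ((q * k : GraphProduct Γ G) : Ix Γ G v) = k := hqi
    have h3 := QuotientGroup.eq.1 h2.symm
    have h4 := ret_mem (A := {v}ᶜ) h3
    have e : (psi Γ G v x * ret {v}ᶜ k)⁻¹ * f h * (psi Γ G v x * ret {v}ᶜ k) =
        GraphProduct.of Γ G v a * ret {v}ᶜ (k⁻¹ * (q * k)) := by
      calc _ = (psi Γ G v x * ret {v}ᶜ k)⁻¹ * (f h * psi Γ G v x) * ret {v}ᶜ k := by group
        _ = _ := by rw [this, map_mul, map_mul, map_inv]; group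
    rw [e]
    refine mul_mem (of_mem (Set.mem_insert _ _) a) (vsub_mono ?_ h4)
    exact Set.inter_subset_left.trans (Set.subset_insert _ _)

theorem finite_sub [Finite V] {H : Type*} [Group H] [Finite H] (n : ℕ) : ∀ (A : Set V),
    A.ncard = n → ∀ (f : H →* GraphProduct Γ G), (∀ h, f h ∈ GraphProduct.vsub Γ G A) →
    ∃ C, Γ.IsClique C ∧ ∃ g, ∀ h, g⁻¹ * f h * g ∈ GraphProduct.vsub Γ G C := by
  induction n using Nat.strong_induction_on with
  | _ n ih =>
  intro A hA f hf
  by_cases hc : Γ.IsClique A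
  · exact ⟨A, hc, 1, by simpa using hf⟩
  obtain ⟨v, hv, w, hw, hne, hadj⟩ : ∃ v ∈ A, ∃ w ∈ A, v ≠ w ∧ ¬ Γ.Adj v w := by
    by_contra hcon
    push Not at hcon
    exact hc fun v hv w hw hne => hcon v hv w hw hne
  have step : ∀ B : Set V, (∃ x ∈ A, x ∉ B) →
      (∃ g, ∀ h, g⁻¹ * f h * g ∈ GraphProduct.vsub Γ G B) →
      ∃ C, Γ.IsClique C ∧ ∃ g, ∀ h, g⁻¹ * f h * g ∈ GraphProduct.vsub Γ G C := by
    rintro B ⟨x, hxA, hxB⟩ ⟨g, hg⟩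
    have hlt : (B ∩ A).ncard < n := by
      rw [← hA]
      refine Set.ncard_lt_ncard ⟨Set.inter_subset_right, fun h => hxB (h hxA).1⟩
    have hg' : ∀ h, (ret A g)⁻¹ * f h * ret A g ∈ GraphProduct.vsub Γ G (B ∩ A) := by
      intro h
      have := ret_mem (A := A) (hg h)
      rwa [map_mul, map_mul, map_inv, ret_eq (hf h)] at this
    obtain ⟨C, hC, k, hk⟩ := ih _ hlt (B ∩ A) rfl
      ((MulAut.conj (ret A g)⁻¹).toMonoidHom.comp f) (fun h => by simpa using hg' h)
    refine ⟨C, hC, ret A g * k, fun h => ?_⟩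
    have := hk h
    simpa [mul_assoc] using this
  rcases split_finite v f with h | h
  · exact step _ ⟨v, hv, by simp⟩ h
  · exact step _ ⟨w, hw, by simp [hne.symm, hadj]⟩ h

open Classical in
/-- the map to the direct product -/
noncomputable def pr : GraphProduct Γ G →* ∀ v, G v :=
  lift (fun v => MonoidHom.mulSingle G v) (fun _ _ h a b => Pi.mulSingle_commute h.ne a b)

open Classical in
theorem pr_of (v : V) (a : G v) : pr (GraphProduct.of Γ G v a) = Pi.mulSingle v a := lift_of _ _ _ _

theorem pr_of_same (v : V) (a : G v) : pr (GraphProduct.of Γ G v a) v = a := by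
  classical
  rw [pr_of]; simp

theorem pr_not_mem {A : Set V} {v : V} (hv : v ∉ A) {x : GraphProduct Γ G}
    (hx : x ∈ GraphProduct.vsub Γ G A) : pr x v = 1 := by
  classical
  have : GraphProduct.vsub Γ G A ≤ ((Pi.evalMonoidHom G v).comp pr).ker := by
    refine vsub_le fun u hu a => ?_
    rw [MonoidHom.mem_ker, MonoidHom.comp_apply, pr_of]
    simp only [Pi.evalMonoidHom_apply]
    exact Pi.mulSingle_eq_of_ne (by rintro rfl; exact hv hu) a
  exact this hx

theorem pr_conj_not_mem {A : Set V} {v : V} (hv : v ∉ A) {x g : GraphProduct Γ G}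
    (hx : g⁻¹ * x * g ∈ GraphProduct.vsub Γ G A) : pr x v = 1 := by
  have := pr_not_mem hv hx
  simp only [map_mul, map_inv, Pi.mul_apply, Pi.inv_apply] at this
  have h : pr x v = pr g v * ((pr g v)⁻¹ * pr x v * pr g v) * (pr g v)⁻¹ := by group
  rw [h, this]; simp

theorem clique_param [Finite V] {C : Set V} (hC : Γ.IsClique C) :
    ∃ m : (∀ c : C, G c) →* GraphProduct Γ G, m.range = GraphProduct.vsub Γ G C ∧
      ∀ (f : ∀ c : C, G c) (c : C), pr (m f) (c : V) = f c := by
  classical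
  have := Fintype.ofFinite C
  have hcomm : Pairwise fun i j : C => ∀ (x : G i) (y : G j),
      Commute (GraphProduct.of Γ G i x) (GraphProduct.of Γ G j y) :=
    fun i j hij x y => of_comm (hC i.2 j.2 (fun h => hij (Subtype.ext h))) x y
  refine ⟨MonoidHom.noncommPiCoprod (fun c : C => GraphProduct.of Γ G c) hcomm, ?_, ?_⟩
  · rw [MonoidHom.noncommPiCoprod_range, GraphProduct.vsub, iSup_subtype]
  · intro f c
    have : ((Pi.evalMonoidHom G c.1).comp pr).comp
        (MonoidHom.noncommPiCoprod (fun c : C => GraphProduct.of Γ G c) hcomm) =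
        Pi.evalMonoidHom (fun c : C => G c) c := by
      refine MonoidHom.pi_ext fun d x => ?_
      simp only [MonoidHom.comp_apply, MonoidHom.noncommPiCoprod_mulSingle, pr_of,
        Pi.evalMonoidHom_apply]
      by_cases h : c = d
      · subst h; simp
      · rw [Pi.mulSingle_eq_of_ne h, Pi.mulSingle_eq_of_ne (fun h' => h (Subtype.ext h'))]
    exact DFunLike.congr_fun this f

theorem clique_finite [Finite V] [∀ v, Finite (G v)] {C : Set V} (hC : Γ.IsClique C) :
    Finite (GraphProduct.vsub Γ G C) := by
  obtain ⟨m, hm, -⟩ := clique_param (G := G) hC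
  rw [← hm]
  exact Set.finite_range m

theorem clique_pr [Finite V] {C : Set V} (hC : Γ.IsClique C) {x : GraphProduct Γ G}
    (hx : x ∈ GraphProduct.vsub Γ G C) (h1 : x ≠ 1) : ∃ v, pr x v ≠ 1 := by
  obtain ⟨m, hm, hp⟩ := clique_param (G := G) hC
  rw [← hm] at hx
  obtain ⟨f, rfl⟩ := hx
  by_contra hcon
  push Not at hcon
  apply h1
  have : f = 1 := funext fun c => (hp f c).symm.trans (hcon c)
  rw [this, map_one]

theorem exists_maximal [Finite V] {C : Set V} (hC : Γ.IsClique C) :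
    ∃ D, C ⊆ D ∧ Maximal Γ.IsClique D :=
  (Set.toFinite {D | Γ.IsClique D}).exists_le_maximal hC

theorem T1_inter [Finite V]
    (hT1 : ∀ u v : V, Γ.Adj u v → ∃ w : V, w ≠ u ∧ w ≠ v ∧ Γ.Adj u w ∧ ¬ Γ.Adj v w)
    {u v : V} (h : ∀ C, Maximal Γ.IsClique C → v ∈ C → u ∈ C) : u = v := by
  by_contra hne
  obtain ⟨C, hC, hCm⟩ := exists_maximal (Γ := Γ) (C := {v}) (by simp)
  have hv : v ∈ C := hC rfl
  have hadj : Γ.Adj v u := hCm.1 hv (h C hCm hv) (Ne.symm hne)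
  obtain ⟨w, hwv, hwu, h1, h2⟩ := hT1 v u hadj
  obtain ⟨D, hD, hDm⟩ := exists_maximal (Γ := Γ) (C := {v, w}) (by
    rw [SimpleGraph.isClique_pair]; exact fun _ => h1)
  exact h2 (hDm.1 (h D hDm (hD (by simp))) (hD (by simp)) (Ne.symm hwu))

theorem adj_iff [Finite V] {u v : V} (hne : u ≠ v) :
    Γ.Adj u v ↔ ∃ C, Maximal Γ.IsClique C ∧ u ∈ C ∧ v ∈ C := by
  constructor
  · intro h
    obtain ⟨D, hD, hDm⟩ := exists_maximal (Γ := Γ) (C := {u, v}) (by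
      rw [SimpleGraph.isClique_pair]; exact fun _ => h)
    exact ⟨D, hDm, hD (by simp), hD (by simp)⟩
  · rintro ⟨C, hC, hu, hv⟩
    exact hC.1 hu hv hne

section iso
variable {V' : Type*} {Γ' : SimpleGraph V'} {G' : V' → Type*} [∀ v, Group (G' v)]

/-- `e` maps `G(C)` into a conjugate of `G'(C')` -/
def Into (e : GraphProduct Γ G ≃* GraphProduct Γ' G') (C : Set V) (C' : Set V') : Prop :=
  ∃ g, ∀ x ∈ GraphProduct.vsub Γ G C, g⁻¹ * e x * g ∈ GraphProduct.vsub Γ' G' C'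

/-- correspondence of cliques -/
def Rel (e : GraphProduct Γ G ≃* GraphProduct Γ' G') (C : Set V) (C' : Set V') : Prop :=
  Into e C C' ∧ Into e.symm C' C

theorem into_comp [∀ v, Nontrivial (G v)] {e : GraphProduct Γ G ≃* GraphProduct Γ' G'}
    {C D : Set V} {C' D' : Set V'}
    (h : Into e C C') (hs : C' ⊆ D') (h' : Into e.symm D' D) : C ⊆ D := by
  intro v hv
  obtain ⟨g, hg⟩ := h
  obtain ⟨k, hk⟩ := h'
  obtain ⟨a, ha⟩ := exists_ne (1 : G v)
  by_contra hvD
  have h1 := hk _ (vsub_mono hs (hg _ (of_mem hv a)))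
  have h2 : (e.symm g * k)⁻¹ * GraphProduct.of Γ G v a * (e.symm g * k) ∈
      GraphProduct.vsub Γ G D := by
    simpa [mul_assoc] using h1
  have := pr_conj_not_mem hvD h2
  rw [pr_of_same] at this
  exact ha this

theorem exists_into [Finite V] [Finite V'] [∀ v, Finite (G v)]
    (e : GraphProduct Γ G ≃* GraphProduct Γ' G') {C : Set V} (hC : Γ.IsClique C) :
    ∃ C', Maximal Γ'.IsClique C' ∧ Into e C C' := by
  have := clique_finite (G := G) hC
  obtain ⟨D, hD, g, hg⟩ := finite_sub _ Set.univ rfl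
    (e.toMonoidHom.comp (GraphProduct.vsub Γ G C).subtype) (fun h => mem_univ _)
  obtain ⟨C', hDC, hC'⟩ := exists_maximal hD
  exact ⟨C', hC', g, fun x hx => vsub_mono hDC (hg ⟨x, hx⟩)⟩

theorem exists_rel [Finite V] [Finite V'] [∀ v, Finite (G v)] [∀ v, Finite (G' v)]
    [∀ v, Nontrivial (G v)]
    (e : GraphProduct Γ G ≃* GraphProduct Γ' G') {C : Set V} (hC : Maximal Γ.IsClique C) :
    ∃ C', Maximal Γ'.IsClique C' ∧ Rel e C C' := by
  obtain ⟨C', hC', h⟩ := exists_into e hC.1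
  obtain ⟨D, hD, h'⟩ := exists_into e.symm hC'.1
  have hCD : C ⊆ D := into_comp h subset_rfl h'
  have : C = D := hCD.antisymm (hC.2 hD.1 hCD)
  subst this
  exact ⟨C', hC', h, h'⟩

theorem exists_supp [Finite V] [Finite V'] [∀ v, Finite (G v)]
    (e : GraphProduct Γ G ≃* GraphProduct Γ' G') (v : V) (a : G v) (ha : a ≠ 1) :
    ∃ w, pr (e (GraphProduct.of Γ G v a)) w ≠ 1 ∧ ∀ C C', Rel e C C' → v ∈ C → w ∈ C' := by
  obtain ⟨D, hD, g, hg⟩ := finite_sub _ Set.univ rfl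
    (e.toMonoidHom.comp (GraphProduct.of Γ G v)) (fun h => mem_univ _)
  have hne : g⁻¹ * e (GraphProduct.of Γ G v a) * g ≠ 1 := by
    intro h
    have h1 : e (GraphProduct.of Γ G v a) = 1 := by
      calc _ = g * (g⁻¹ * e (GraphProduct.of Γ G v a) * g) * g⁻¹ := by group
        _ = 1 := by rw [h]; simp
    have h2 : GraphProduct.of Γ G v a = 1 := by simpa using h1
    have := pr_of_same (Γ := Γ) v a
    rw [h2, map_one] at this
    exact ha this.symm
  obtain ⟨w, hw⟩ := clique_pr hD (hg a) hne
  have hw' : pr (e (GraphProduct.of Γ G v a)) w ≠ 1 := by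
    intro h
    apply hw
    simp [h]
  refine ⟨w, hw', fun C C' h hv => ?_⟩
  by_contra hwC
  obtain ⟨k, hk⟩ := h.1
  exact hw' (pr_conj_not_mem hwC (hk _ (of_mem hv a)))

/-- correspondence of vertices -/
def VRel (e : GraphProduct Γ G ≃* GraphProduct Γ' G') (v : V) (w : V') : Prop :=
  ∀ C C', Maximal Γ.IsClique C → Maximal Γ'.IsClique C' → Rel e C C' → (v ∈ C ↔ w ∈ C')

theorem Rel.symm {e : GraphProduct Γ G ≃* GraphProduct Γ' G'} {C : Set V} {C' : Set V'}
    (h : Rel e C C') : Rel e.symm C' C := ⟨h.2, h.1⟩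

theorem Rel.symm' {e : GraphProduct Γ G ≃* GraphProduct Γ' G'} {C : Set V} {C' : Set V'}
    (h : Rel e.symm C' C) : Rel e C C' := ⟨h.2, h.1⟩

theorem VRel.symm' {e : GraphProduct Γ G ≃* GraphProduct Γ' G'} {v : V} {w : V'}
    (h : VRel e.symm w v) : VRel e v w := fun C C' hC hC' hr => (h C' C hC' hC hr.symm).symm

theorem VRel.symm {e : GraphProduct Γ G ≃* GraphProduct Γ' G'} {v : V} {w : V'}
    (h : VRel e v w) : VRel e.symm w v := fun C C' hC hC' hr => (h C' C hC' hC hr.symm').symm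

variable [Finite V] [Finite V'] [∀ v, Finite (G v)] [∀ v, Finite (G' v)]
    [∀ v, Nontrivial (G v)] [∀ v, Nontrivial (G' v)]

theorem exists_vrel (e : GraphProduct Γ G ≃* GraphProduct Γ' G')
    (hT1 : ∀ u v : V, Γ.Adj u v → ∃ w : V, w ≠ u ∧ w ≠ v ∧ Γ.Adj u w ∧ ¬ Γ.Adj v w)
    (v : V) (a : G v) (ha : a ≠ 1) :
    ∃ w, pr (e (GraphProduct.of Γ G v a)) w ≠ 1 ∧ VRel e v w := by
  obtain ⟨w, hw, h⟩ := exists_supp e v a ha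
  refine ⟨w, hw, fun C C' hC hC' hr => ⟨h C C' hr, fun hwC => ?_⟩⟩
  obtain ⟨b, hb⟩ := exists_ne (1 : G' w)
  obtain ⟨v1, -, h1⟩ := exists_supp e.symm w b hb
  have : v1 = v := by
    refine T1_inter hT1 fun D hD hvD => ?_
    obtain ⟨D', hD', hrD⟩ := exists_rel e hD
    exact h1 D' D hrD.symm (h D D' hrD hvD)
  subst this
  exact h1 C' C hr.symm hwC

theorem vrel_unique (e : GraphProduct Γ G ≃* GraphProduct Γ' G')
    (hT1' : ∀ u v : V', Γ'.Adj u v → ∃ w : V', w ≠ u ∧ w ≠ v ∧ Γ'.Adj u w ∧ ¬ Γ'.Adj v w)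
    {v : V} {w w' : V'} (h : VRel e v w) (h' : VRel e v w') : w = w' := by
  refine T1_inter hT1' fun C' hC' hw => ?_
  obtain ⟨C, hC, hr⟩ := exists_rel e.symm hC'
  exact (h C C' hC hC' hr.symm').1 ((h' C C' hC hC' hr.symm').2 hw)

theorem vrel_inj (e : GraphProduct Γ G ≃* GraphProduct Γ' G')
    (hT1 : ∀ u v : V, Γ.Adj u v → ∃ w : V, w ≠ u ∧ w ≠ v ∧ Γ.Adj u w ∧ ¬ Γ.Adj v w)
    (hT1' : ∀ u v : V', Γ'.Adj u v → ∃ w : V', w ≠ u ∧ w ≠ v ∧ Γ'.Adj u w ∧ ¬ Γ'.Adj v w)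
    {v : V} {w : V'} (h : VRel e v w) :
    Function.Injective (((Pi.evalMonoidHom G' w).comp pr).comp
      (e.toMonoidHom.comp (GraphProduct.of Γ G v))) := by
  rw [injective_iff_map_eq_one]
  intro a ha
  by_contra hne
  obtain ⟨w', hw', h'⟩ := exists_vrel e hT1 v a hne
  have := vrel_unique e hT1' h h'
  subst this
  exact hw' ha

theorem vrel_adj (e : GraphProduct Γ G ≃* GraphProduct Γ' G')
    {u v : V} {x y : V'} (h : VRel e u x) (h' : VRel e v y) (hne : u ≠ v) (hne' : x ≠ y)
    (hadj : Γ.Adj u v) : Γ'.Adj x y := by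
  rw [adj_iff hne] at hadj
  rw [adj_iff hne']
  obtain ⟨C, hC, hu, hv⟩ := hadj
  obtain ⟨C', hC', hr⟩ := exists_rel e hC
  exact ⟨C', hC', (h C C' hC hC' hr).1 hu, (h' C C' hC hC' hr).1 hv⟩

end iso
end GP
end GP

/-- If `Γ` and `Γ'` are `T₁` graphs and the graph products of `(Γ, G)` and
`(Γ', G')` (with nontrivial finite vertex groups) are isomorphic, then there is a graph
isomorphism `ψ : Γ ≃g Γ'` with `G_v ≅ G'_{ψ v}` for all `v`. -/
theorem graphProduct_rigidity_T1 {V V' : Type*} [Fintype V] [Fintype V']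
    (Γ : SimpleGraph V) (Γ' : SimpleGraph V')
    (G : V → Type*) [∀ v, Group (G v)] [∀ v, Finite (G v)] [∀ v, Nontrivial (G v)]
    (G' : V' → Type*) [∀ v', Group (G' v')] [∀ v', Finite (G' v')] [∀ v', Nontrivial (G' v')]
    (hT1 : ∀ u v : V, Γ.Adj u v → ∃ w : V, w ≠ u ∧ w ≠ v ∧ Γ.Adj u w ∧ ¬ Γ.Adj v w)
    (hT1' : ∀ u v : V', Γ'.Adj u v → ∃ w : V', w ≠ u ∧ w ≠ v ∧ Γ'.Adj u w ∧ ¬ Γ'.Adj v w)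
    (hiso : Nonempty (GraphProduct Γ G ≃* GraphProduct Γ' G')) :
    ∃ ψ : Γ ≃g Γ', ∀ v : V, Nonempty (G v ≃* G' (ψ v)) := by
  obtain ⟨e⟩ := hiso
  have h1 : ∀ v, ∃ w, GP.VRel e v w := fun v => by
    obtain ⟨a, ha⟩ := exists_ne (1 : G v)
    obtain ⟨w, -, hw⟩ := GP.exists_vrel e hT1 v a ha
    exact ⟨w, hw⟩
  have h2 : ∀ w, ∃ v, GP.VRel e v w := fun w => by
    obtain ⟨a, ha⟩ := exists_ne (1 : G' w)
    obtain ⟨v, -, hv⟩ := GP.exists_vrel e.symm hT1' w a ha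
    exact ⟨v, hv.symm'⟩
  choose f hf using h1
  choose g hg using h2
  have hgf : ∀ v, g (f v) = v := fun v =>
    GP.vrel_unique e.symm hT1 (hg (f v)).symm (hf v).symm
  have hfg : ∀ w, f (g w) = w := fun w => GP.vrel_unique e hT1' (hf (g w)) (hg w)
  let E : V ≃ V' := ⟨f, g, hgf, hfg⟩
  refine ⟨⟨E, ?_⟩, fun v => ?_⟩
  · intro u v
    by_cases hne : u = v
    · subst hne; simp
    have hne' : f u ≠ f v := fun h => hne (E.injective h)
    exact ⟨GP.vrel_adj e.symm (hf u).symm (hf v).symm hne' hne,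
      GP.vrel_adj e (hf u) (hf v) hne hne'⟩
  · have i1 := GP.vrel_inj e hT1 hT1' (hf v)
    have i2 := GP.vrel_inj e.symm hT1' hT1 (hf v).symm
    exact ⟨MulEquiv.ofBijective _ (i1.bijective_of_nat_card_le (Nat.card_le_card_of_injective _ i2))⟩
end

section
/- Let Γ = (V,E) and Γ' = (V',E') be finite simple graphs satisfying the T₀ condition, with families of nontrivial finite vertex groups (G_v)_{v∈V} and (G'_{v'})_{v'∈V'}. If the graph product of (Γ, G_v) is isomorphic as a group to the graph product of (Γ', G'_{v'}), then there exists a graph isomorphism ψ : Γ → Γ' such that G_v is isomorphic to G'_{ψ(v)} for every v ∈ V. -/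
open Monoid

namespace GPR

/-! ### Free products with a permutation action on the factors -/

section Free

variable {X K : Type*} [Group K]

/-- Free product of copies of `K` indexed by `X`. -/
abbrev FP (X K : Type*) [Group K] := CoprodI (fun _ : X => K)

/-- The inclusion of the factor with index `x`. -/
def inc (x : X) : K →* FP X K := CoprodI.of (M := fun _ : X => K) (i := x)

def Red (l : List (Σ _ : X, K)) : Prop :=
  (∀ p ∈ l, p.2 ≠ 1) ∧ l.IsChain (fun a b => a.1 ≠ b.1)

def pr (l : List (Σ _ : X, K)) : FP X K := (l.map fun p => inc p.1 p.2).prod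

open Classical in
noncomputable def len (f : FP X K) : ℕ := (CoprodI.Word.equiv f).toList.length

lemma pr_nil : pr ([] : List (Σ _ : X, K)) = 1 := rfl

lemma pr_cons (p : Σ _ : X, K) (l : List (Σ _ : X, K)) : pr (p :: l) = inc p.1 p.2 * pr l := by
  simp [pr]

lemma len_pr (l : List (Σ _ : X, K)) (h : Red l) : len (pr l) = l.length := by
  classical
  have : pr l = CoprodI.Word.equiv.symm (⟨l, h.1, h.2⟩ : CoprodI.Word (fun _ : X => K)) := rfl
  rw [len, this]
  have := CoprodI.Word.equiv.apply_symm_apply (⟨l, h.1, h.2⟩ : CoprodI.Word (fun _ : X => K))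
  convert congrArg (fun w => w.toList.length) this

lemma exists_red (f : FP X K) : ∃ l : List (Σ _ : X, K), Red l ∧ pr l = f := by
  classical
  refine ⟨(CoprodI.Word.equiv f).toList, ⟨(CoprodI.Word.equiv f).ne_one,
    (CoprodI.Word.equiv f).chain_ne⟩, ?_⟩
  exact CoprodI.Word.equiv.symm_apply_apply f

lemma red_cons {p : Σ _ : X, K} {l : List (Σ _ : X, K)} :
    Red (p :: l) ↔ p.2 ≠ 1 ∧ (∀ q ∈ l.head?, p.1 ≠ q.1) ∧ Red l := by
  simp only [Red, List.mem_cons, forall_eq_or_imp, List.isChain_cons]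
  tauto

lemma red_nil : Red ([] : List (Σ _ : X, K)) := by simp [Red]

lemma len_one : len (1 : FP X K) = 0 := by
  rw [← pr_nil, len_pr _ red_nil]; rfl

lemma len_inc (x : X) {k : K} (hk : k ≠ 1) : len (inc x k) = 1 := by
  have : inc x k = pr [⟨x, k⟩] := by simp [pr]
  rw [this, len_pr]
  · rfl
  · simp [Red, hk]

lemma eq_inc_of_len_le_one [Nonempty X] {f : FP X K} (h : len f ≤ 1) : ∃ x k, f = inc x k := by
  obtain ⟨l, hl, rfl⟩ := exists_red f
  rw [len_pr l hl] at h
  match l, h with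
  | [], _ => exact ⟨Classical.arbitrary X, 1, by simp [pr_nil]⟩
  | [p], _ => exact ⟨p.1, p.2, by simp [pr]⟩

lemma inc_index {x y : X} {k l : K} (hk : k ≠ 1) (hl : l ≠ 1)
    (h : len (inc x k * inc y l) ≤ 1) : x = y := by
  by_contra hxy
  have : inc x k * inc y l = pr [⟨x, k⟩, ⟨y, l⟩] := by simp [pr]
  rw [this, len_pr] at h
  · simp at h
  · simp [Red, hk, hl, hxy]

lemma inc_injective (x : X) : Function.Injective (inc x : K →* FP X K) :=
  CoprodI.of_injective (M := fun _ : X => K) x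

lemma len_inv_mul (r : List (Σ _ : X, K)) : ∀ p : List (Σ _ : X, K), Red r → Red p →
    (∀ a ∈ r.head?, ∀ b ∈ p.head?, a.1 ≠ b.1) → len ((pr r)⁻¹ * pr p) = r.length + p.length := by
  induction r with
  | nil => intro p _ hp _; simp [pr_nil, len_pr p hp]
  | cons a r ih =>
    intro p hr hp hh
    rw [red_cons] at hr
    have e : (pr (a :: r))⁻¹ * pr p = (pr r)⁻¹ * pr (⟨a.1, a.2⁻¹⟩ :: p) := by
      simp [pr_cons, mul_assoc]
    rw [e, ih _ hr.2.2]
    · simp; omega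
    · rw [red_cons]
      refine ⟨by simpa using hr.1, ?_, hp⟩
      intro q hq
      exact hh a (by simp) q hq
    · intro b hb c hc
      simp at hc
      subst hc
      exact (hr.2.1 b hb).symm

/-- The midpoint lemma. -/
lemma key (f : FP X K) (hf : 2 ≤ len f) :
    ∃ s : FP X K, ∀ o : FP X K, len (s⁻¹ * o) < max (len o) (len (f⁻¹ * o)) := by
  obtain ⟨l, hl, rfl⟩ := exists_red f
  rw [len_pr l hl] at hf
  match l, hf, hl with
  | a :: b :: r, _, hl =>
    have hl' := red_cons.1 hl
    refine ⟨inc a.1 a.2, fun o => ?_⟩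
    -- reduce to a word starting with the index of `a`
    have main : ∀ (k : K) (m : List (Σ _ : X, K)), Red (⟨a.1, k⟩ :: m) →
        (inc a.1 a.2)⁻¹ * o = pr (⟨a.1, k⟩ :: m) →
        len ((inc a.1 a.2)⁻¹ * o) < max (len o) (len ((pr (a :: b :: r))⁻¹ * o)) := by
      intro k m hm e
      have e2 : (pr (a :: b :: r))⁻¹ * o = (pr (b :: r))⁻¹ * pr (⟨a.1, k⟩ :: m) := by
        rw [← e, pr_cons a, mul_inv_rev, mul_assoc]
      have h3 := len_inv_mul (b :: r) _ hl'.2.2 hm (by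
        intro c hc d hd
        simp at hc hd
        subst hc hd
        exact (hl'.2.1 b (by simp)).symm)
      rw [e2, h3, e, len_pr _ hm]
      apply lt_max_of_lt_right
      simp
    obtain ⟨m, hm, rfl⟩ := exists_red o
    match m, hm with
    | [], hm =>
      refine main a.2⁻¹ [] ?_ ?_
      · simp [Red]; exact hl'.1
      · simp [pr]
    | ⟨x, t⟩ :: m, hm =>
      by_cases hx : a.1 = x
      · subst hx
        have hm' := red_cons.1 hm
        by_cases ht : t = a.2
        · subst ht
          apply lt_max_of_lt_left
          rw [len_pr _ hm, pr_cons, inv_mul_cancel_left, len_pr _ hm'.2.2]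
          simp
        · refine main (a.2⁻¹ * t) m ?_ ?_
          · rw [red_cons]
            refine ⟨?_, hm'.2⟩
            intro h
            exact ht (inv_mul_eq_one.1 h).symm
          · simp [pr_cons, mul_assoc]
      · refine main a.2⁻¹ (⟨x, t⟩ :: m) ?_ ?_
        · rw [red_cons]
          refine ⟨by simpa using hl'.1, ?_, hm⟩
          simpa using hx
        · simp [pr_cons]

variable {A : Type*} [Group A] [MulAction A X]

/-- The permutation action on the free product. -/
def permHom (a : A) : FP X K →* FP X K := CoprodI.lift (fun x => inc (a • x))

lemma permHom_inc (a : A) (x : X) (k : K) : permHom a (inc x k) = inc (a • x) k := by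
  simp only [permHom, inc]
  exact CoprodI.lift_of _ _

lemma FP_ext {N : Type*} [Monoid N] {f g : FP X K →* N} (h : ∀ x k, f (inc x k) = g (inc x k)) :
    f = g := CoprodI.ext_hom _ _ fun i => MonoidHom.ext fun k => h i k

lemma permHom_one : permHom (1 : A) = MonoidHom.id (FP X K) :=
  FP_ext fun x k => by simp [permHom_inc]

lemma permHom_mul (a b : A) : (permHom (a * b) : FP X K →* FP X K) = (permHom a).comp (permHom b) :=
  FP_ext fun x k => by simp [permHom_inc, mul_smul]

variable (X K A) in
def perm : A →* MulAut (FP X K) where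
  toFun a := MonoidHom.toMulEquiv (permHom a) (permHom a⁻¹)
    (by rw [← permHom_mul, inv_mul_cancel, permHom_one])
    (by rw [← permHom_mul, mul_inv_cancel, permHom_one])
  map_one' := by
    ext f
    exact DFunLike.congr_fun permHom_one f
  map_mul' a b := by
    ext f
    exact DFunLike.congr_fun (permHom_mul a b) f

lemma perm_inc (a : A) (x : X) (k : K) : perm X K A a (inc x k) = inc (a • x) k :=
  permHom_inc a x k

lemma len_perm (a : A) (f : FP X K) : len (perm X K A a f) = len f := by
  obtain ⟨l, hl, rfl⟩ := exists_red f
  have : perm X K A a (pr l) = pr (l.map fun p => ⟨a • p.1, p.2⟩) := by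
    clear hl
    induction l with
    | nil => simp [pr_nil]
    | cons p l ih => simp [pr_cons, ih, perm_inc]
  rw [this, len_pr _ hl, len_pr]
  · simp
  · refine ⟨?_, ?_⟩
    · intro p hp
      simp only [List.mem_map] at hp
      obtain ⟨q, hq, rfl⟩ := hp
      exact hl.1 q hq
    · rw [List.isChain_map]
      refine hl.2.imp ?_
      intro p q h h2
      exact h (MulAction.injective a h2)

/-- Finite subgroups of `(*_X K) ⋊ A`. -/
theorem finite_sub [Nonempty X] (H : Subgroup (FP X K ⋊[perm X K A] A)) [Finite H] :
    ∃ f : FP X K, (∀ h ∈ H, f⁻¹ * h.left * perm X K A h.right f = 1) ∨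
      ∃ x : X, ∀ h ∈ H, h.right • x = x ∧
        ∃ k : K, f⁻¹ * h.left * perm X K A h.right f = inc x k := by
  classical
  have := Fintype.ofFinite H
  -- affine action
  let act : (FP X K ⋊[perm X K A] A) → FP X K → FP X K := fun h f => h.left * perm X K A h.right f
  have act_mul : ∀ h h' f, act (h * h') f = act h (act h' f) := by
    intro h h' f
    simp [act, mul_assoc]
  have act_len : ∀ h f g, len ((act h f)⁻¹ * act h g) = len (f⁻¹ * g) := by
    intro h f g
    have : (act h f)⁻¹ * act h g = perm X K A h.right (f⁻¹ * g) := by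
      simp [act, mul_assoc]
    rw [this, len_perm]
  let rad : FP X K → ℕ := fun f => Finset.univ.sup fun h : H => len (f⁻¹ * act h 1)
  have rad_act : ∀ (h : H) f, rad (act h f) ≤ rad f := by
    intro h f
    refine Finset.sup_le fun h' _ => ?_
    have : act h' 1 = act h (act (h⁻¹ * h' : H) 1) := by
      rw [← act_mul]; simp
    rw [this, act_len]
    exact Finset.le_sup (f := fun h : H => len (f⁻¹ * act h 1)) (Finset.mem_univ (h⁻¹ * h'))
  obtain ⟨f, hf⟩ : ∃ f, ∀ g, rad f ≤ rad g := by
    obtain ⟨f, hf⟩ := WellFounded.has_min (measure rad).wf Set.univ ⟨1, trivial⟩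
    exact ⟨f, fun g => not_lt.1 (hf.2 g trivial)⟩
  have close : ∀ g g', rad g ≤ rad f → rad g' ≤ rad f → len (g⁻¹ * g') ≤ 1 := by
    intro g g' hg hg'
    by_contra hlt
    obtain ⟨s, hs⟩ := key (g⁻¹ * g') (by omega)
    have : rad (g * s) < rad f := by
      have hne : (Finset.univ : Finset H).Nonempty := ⟨1, Finset.mem_univ _⟩
      obtain ⟨h, -, hh⟩ := Finset.exists_mem_eq_sup _ hne fun h : H => len ((g * s)⁻¹ * act h 1)
      have h1 := hs (g⁻¹ * act h 1)
      have h2 : len (g⁻¹ * act h 1) ≤ rad g :=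
        Finset.le_sup (f := fun h : H => len (g⁻¹ * act h 1)) (Finset.mem_univ h)
      have h3 : len (g'⁻¹ * act h 1) ≤ rad g' :=
        Finset.le_sup (f := fun h : H => len (g'⁻¹ * act h 1)) (Finset.mem_univ h)
      have e1 : (g⁻¹ * g')⁻¹ * (g⁻¹ * act h 1) = g'⁻¹ * act h 1 := by group
      have e2 : (g * s)⁻¹ * act h 1 = s⁻¹ * (g⁻¹ * act h 1) := by group
      rw [e1] at h1
      change Finset.univ.sup (fun h : H => len ((g * s)⁻¹ * act h 1)) < _
      rw [hh]
      rw [e2]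
      omega
    exact absurd (hf (g * s)) (by omega)
  have len_zero : ∀ g : FP X K, len g = 0 → g = 1 := by
    intro g hg
    obtain ⟨l, hl, rfl⟩ := exists_red g
    rw [len_pr l hl, List.length_eq_zero_iff] at hg
    subst hg; rfl
  refine ⟨f, ?_⟩
  by_cases huniq : ∀ g, rad g ≤ rad f → g = f
  · left
    intro h hh
    have := huniq _ (rad_act ⟨h, hh⟩ f)
    change h.left * perm X K A h.right f = f at this
    rw [mul_assoc, this, inv_mul_cancel]
  · right
    push Not at huniq
    obtain ⟨f', hf', hne⟩ := huniq
    obtain ⟨x, k, hk⟩ := eq_inc_of_len_le_one (close f f' le_rfl hf')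
    have hk1 : k ≠ 1 := by
      rintro rfl
      rw [map_one, inv_mul_eq_one] at hk
      exact hne hk.symm
    have inblock : ∀ g, rad g ≤ rad f → ∃ m, f⁻¹ * g = inc x m := by
      intro g hg
      obtain ⟨y, m, hm⟩ := eq_inc_of_len_le_one (close f g le_rfl hg)
      by_cases hm1 : m = 1
      · exact ⟨1, by rw [hm, hm1]; simp⟩
      have h2 := close f' g hf' hg
      have e : f'⁻¹ * g = inc x k⁻¹ * inc y m := by
        rw [map_inv, ← hk, ← hm]; group
      rw [e] at h2
      have := inc_index (inv_ne_one.2 hk1) hm1 h2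
      subst this
      exact ⟨m, hm⟩
    refine ⟨x, fun h hh => ?_⟩
    obtain ⟨m, hm⟩ := inblock _ (rad_act ⟨h, hh⟩ f)
    obtain ⟨m', hm'⟩ := inblock _ ((rad_act ⟨h, hh⟩ f').trans hf')
    refine ⟨?_, m, by rw [mul_assoc]; exact hm⟩
    have e : f' = f * inc x k := by rw [← hk]; group
    have e3 : inc (h.right • x) k = inc x (m⁻¹ * m') := by
      rw [map_mul, map_inv, ← hm, ← hm', e]
      simp only [act, map_mul, perm_inc]
      group
    have h4 : len (inc x k * inc (h.right • x) k) ≤ 1 := by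
      rw [e3, ← map_mul]
      by_cases h5 : k * (m⁻¹ * m') = 1
      · rw [h5, map_one, len_one]; omega
      · rw [len_inc _ h5]
    exact (inc_index hk1 hk1 h4).symm

end Free

/-! ### Splitting a group as a semidirect product with a free product -/

section Split

variable {W A K : Type*} [Group W] [Group A] [Group K] (C : Subgroup A)
  (ι : A →* W) (j : K →* W)

/-- The homomorphism sending `k` to its conjugate by the coset `x`. -/
def conjHom (hc : ∀ c ∈ C, ∀ k, Commute (ι c) (j k)) (x : A ⧸ C) : K →* W :=
  Quotient.liftOn' x (fun a => (MulAut.conj (ι a)).toMonoidHom.comp j) (by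
    intro a b hab
    rw [QuotientGroup.leftRel_apply] at hab
    ext k
    have h := hc _ hab k
    have e : ι b = ι a * ι (a⁻¹ * b) := by simp
    simp only [MonoidHom.comp_apply, MulEquiv.coe_toMonoidHom, MulAut.conj_apply]
    calc ι a * j k * (ι a)⁻¹ = ι a * (j k * ι (a⁻¹ * b)) * (ι a * ι (a⁻¹ * b))⁻¹ := by group
      _ = ι b * j k * (ι b)⁻¹ := by rw [← h.eq, ← mul_assoc (ι a), ← e])

lemma conjHom_mk (hc : ∀ c ∈ C, ∀ k, Commute (ι c) (j k)) (a : A) (k : K) :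
    conjHom C ι j hc (a : A ⧸ C) k = ι a * j k * (ι a)⁻¹ := rfl

/-- The homomorphism from the semidirect product. -/
def sig (hc : ∀ c ∈ C, ∀ k, Commute (ι c) (j k)) : FP (A ⧸ C) K ⋊[perm (A ⧸ C) K A] A →* W :=
  SemidirectProduct.lift (CoprodI.lift (conjHom C ι j hc)) ι (by
    intro a
    refine FP_ext fun x k => ?_
    have h1 : ∀ y, CoprodI.lift (conjHom C ι j hc) (inc y k) = conjHom C ι j hc y k := by
      intro y
      exact CoprodI.lift_of _ _
    simp only [MonoidHom.comp_apply, MulEquiv.coe_toMonoidHom, MulAut.conj_apply, perm_inc, h1]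
    induction x using QuotientGroup.induction_on with
    | H b =>
      have : a • (b : A ⧸ C) = ((a * b : A) : A ⧸ C) := rfl
      rw [this, conjHom_mk, conjHom_mk]
      simp [mul_assoc])

lemma sig_inr (hc : ∀ c ∈ C, ∀ k, Commute (ι c) (j k)) (a : A) : sig C ι j hc (SemidirectProduct.inr a) = ι a := by simp [sig]

lemma sig_inl (hc : ∀ c ∈ C, ∀ k, Commute (ι c) (j k)) (x : A ⧸ C) (k : K) :
    sig C ι j hc (SemidirectProduct.inl (inc x k)) = conjHom C ι j hc x k := by
  rw [sig, SemidirectProduct.lift_inl]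
  exact CoprodI.lift_of _ _

lemma split (hc : ∀ c ∈ C, ∀ k, Commute (ι c) (j k)) (θ : W →* FP (A ⧸ C) K ⋊[perm (A ⧸ C) K A] A)
    (hθ : ∀ w, sig C ι j hc (θ w) = w) (H : Subgroup W) [Finite H] :
    ∃ s : W, (∀ h ∈ H, ∃ a, s⁻¹ * h * s = ι a) ∨
      (∀ h ∈ H, ∃ k, ∃ c ∈ C, s⁻¹ * h * s = j k * ι c) := by
  have hfin : Finite (H.map θ) :=
    Finite.of_surjective _ (θ.subgroupMap_surjective H)
  have base : ∀ (f : FP (A ⧸ C) K) (p : FP (A ⧸ C) K ⋊[perm (A ⧸ C) K A] A),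
      (SemidirectProduct.inl f)⁻¹ * p * SemidirectProduct.inl f =
        SemidirectProduct.inl (f⁻¹ * p.left * perm (A ⧸ C) K A p.right f) *
          SemidirectProduct.inr p.right := by
    intro f p
    ext <;> simp [mul_assoc]
  obtain ⟨f, hf | ⟨x, hx⟩⟩ := finite_sub (H.map θ)
  · refine ⟨sig C ι j hc (SemidirectProduct.inl f), Or.inl fun h hh => ?_⟩
    have h1 := hf (θ h) ⟨h, hh, rfl⟩
    have h2 := congrArg (sig C ι j hc) (base f (θ h))
    rw [h1, map_one, one_mul, sig_inr, map_mul, map_mul, map_inv, hθ] at h2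
    exact ⟨_, h2⟩
  · induction x using QuotientGroup.induction_on with
    | H b =>
    refine ⟨sig C ι j hc (SemidirectProduct.inl f) * ι b, Or.inr fun h hh => ?_⟩
    obtain ⟨hst, k, hk⟩ := hx (θ h) ⟨h, hh, rfl⟩
    have h2 := congrArg (sig C ι j hc) (base f (θ h))
    rw [hk, map_mul, map_mul, map_mul, map_inv, hθ, sig_inr, sig_inl, conjHom_mk] at h2
    have hst' : b⁻¹ * ((θ h).right * b) ∈ C := QuotientGroup.eq.1 hst.symm
    refine ⟨k, _, hst', ?_⟩
    simp only [mul_inv_rev, map_mul, map_inv]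
    calc _ = (ι b)⁻¹ * ((sig C ι j hc (SemidirectProduct.inl f))⁻¹ * h *
          sig C ι j hc (SemidirectProduct.inl f)) * ι b := by group
      _ = _ := by rw [h2]; group

end Split

/-! ### Graph products -/

section GP

open GraphProduct

variable {V : Type*} {Γ : SimpleGraph V} {G : V → Type*} [∀ v, Group (G v)]

lemma of_comm {u v : V} (h : Γ.Adj u v) (g : G u) (k : G v) :
    Commute (of Γ G u g) (of Γ G v k) := by
  have hm : (CoprodI.of g)⁻¹ * (CoprodI.of k)⁻¹ * CoprodI.of g * CoprodI.of k ∈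
      Subgroup.normalClosure (graphProdRels Γ G) :=
    Subgroup.subset_normalClosure ⟨u, v, h, g, k, rfl⟩
  have h1 := (QuotientGroup.eq_one_iff _).2 hm
  have h2 : (of Γ G u g)⁻¹ * (of Γ G v k)⁻¹ * of Γ G u g * of Γ G v k = 1 := h1
  rw [mul_assoc, ← mul_inv_rev, inv_mul_eq_one] at h2
  exact h2.symm

/-- Universal property. -/
def lft {T : Type*} [Group T] (f : ∀ v, G v →* T)
    (hf : ∀ u v, Γ.Adj u v → ∀ g h, Commute (f u g) (f v h)) : GraphProduct Γ G →* T :=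
  QuotientGroup.lift _ (CoprodI.lift f) (by
    intro x hx
    refine (Subgroup.normalClosure_le_normal (N := (CoprodI.lift f).ker) ?_) hx
    rintro _ ⟨u, v, h, g, k, rfl⟩
    have := hf u v h g k
    simp only [SetLike.mem_coe, MonoidHom.mem_ker, map_mul, map_inv, CoprodI.lift_of]
    rw [mul_assoc, ← mul_inv_rev, inv_mul_eq_one]
    exact this.symm)

lemma lft_of {T : Type*} [Group T] (f : ∀ v, G v →* T)
    (hf : ∀ u v, Γ.Adj u v → ∀ g h, Commute (f u g) (f v h)) (v : V) (g : G v) :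
    lft f hf (of Γ G v g) = f v g :=
  CoprodI.lift_of f g

lemma of_mem_vsub {D : Set V} {v : V} (hv : v ∈ D) (g : G v) : of Γ G v g ∈ vsub Γ G D :=
  (le_iSup₂ (f := fun a (_ : a ∈ D) => (of Γ G a).range) v hv) ⟨g, rfl⟩

lemma vsub_le {D : Set V} {S : Subgroup (GraphProduct Γ G)}
    (h : ∀ v ∈ D, ∀ g, of Γ G v g ∈ S) : vsub Γ G D ≤ S := by
  refine iSup₂_le fun v hv => ?_
  rintro _ ⟨g, rfl⟩
  exact h v hv g

lemma vsub_mono {D E : Set V} (h : D ⊆ E) : vsub Γ G D ≤ vsub Γ G E :=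
  vsub_le fun _ hv _ => of_mem_vsub (h hv) _

lemma gen (S : Subgroup (GraphProduct Γ G)) (h : ∀ v g, of Γ G v g ∈ S) (x : GraphProduct Γ G) :
    x ∈ S := by
  induction x using QuotientGroup.induction_on with
  | H y =>
    induction y using CoprodI.induction_on with
    | one => exact S.one_mem
    | of i m => exact h i m
    | mul x y hx hy => exact S.mul_mem hx hy

lemma hom_ext' {T : Type*} [Group T] {f g : GraphProduct Γ G →* T}
    (h : ∀ v k, f (of Γ G v k) = g (of Γ G v k)) (x : GraphProduct Γ G) : f x = g x :=
  gen (MonoidHom.eqLocus f g) h x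

variable (Γ G) in
/-- Inclusion of the graph product over an induced subgraph. -/
def incl (S : Set V) : GraphProduct (Γ.induce S) (fun s : S => G s) →* GraphProduct Γ G :=
  lft (G := fun s : S => G s) (fun s => of Γ G s)
    (fun u v h _ _ => of_comm (Γ := Γ) (u := u.1) (v := v.1) h _ _)

lemma incl_of (S : Set V) (s : S) (g : G s) :
    incl Γ G S (of (Γ.induce S) (fun s : S => G s) s g) = of Γ G s g :=
  lft_of (G := fun s : S => G s) _ _ _ _

lemma incl_vsub (S : Set V) (D : Set S) {x} (hx : x ∈ vsub (Γ.induce S) (fun s : S => G s) D) :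
    incl Γ G S x ∈ vsub Γ G (Subtype.val '' D) := by
  have : vsub (Γ.induce S) (fun s : S => G s) D ≤
      (vsub Γ G (Subtype.val '' D)).comap (incl Γ G S) := by
    refine vsub_le fun v hv g => ?_
    rw [Subgroup.mem_comap, incl_of]
    exact of_mem_vsub (v := v.1) (Set.mem_image_of_mem _ hv) g
  exact this hx

open Classical in
variable (Γ G) in
/-- Retraction to the graph product over an induced subgraph. -/
noncomputable def retr (S : Set V) :
    GraphProduct Γ G →* GraphProduct (Γ.induce S) (fun s : S => G s) :=
  lft (fun v => if h : v ∈ S then of (Γ.induce S) (fun s : S => G s) ⟨v, h⟩ else 1) (by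
    intro u v huv g h
    by_cases hu : u ∈ S
    · by_cases hv : v ∈ S
      · simp only [hu, hv, dif_pos]
        exact of_comm (Γ := Γ.induce S) (G := fun s : S => G s) (u := ⟨u, hu⟩) (v := ⟨v, hv⟩) huv g h
      · simp [hv]
    · simp [hu])

lemma retr_of_mem {S : Set V} {v : V} (hv : v ∈ S) (g : G v) :
    retr Γ G S (of Γ G v g) = of (Γ.induce S) (fun s : S => G s) ⟨v, hv⟩ g := by
  rw [retr, lft_of]; simp [hv]

lemma retr_of_not_mem {S : Set V} {v : V} (hv : v ∉ S) (g : G v) :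
    retr Γ G S (of Γ G v g) = 1 := by
  rw [retr, lft_of]; simp [hv]

/-- Splitting off one vertex. -/
lemma split_vertex (v : V) (H : Subgroup (GraphProduct Γ G)) [Finite H] :
    ∃ s, (∀ h ∈ H, ∃ a, s⁻¹ * h * s = incl Γ G {v}ᶜ a) ∨
      (∀ h ∈ H, ∃ k, ∃ c ∈ vsub Γ G {u | Γ.Adj v u}, s⁻¹ * h * s = of Γ G v k * c) := by
  classical
  let A := GraphProduct (Γ.induce ({v}ᶜ : Set V)) (fun s : ({v}ᶜ : Set V) => G s)
  let L : Set ({v}ᶜ : Set V) := {u | Γ.Adj v u}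
  let C : Subgroup A := vsub _ _ L
  have hLC : ∀ c ∈ C, incl Γ G {v}ᶜ c ∈ vsub Γ G {u | Γ.Adj v u} := by
    intro c hc
    refine vsub_mono ?_ (incl_vsub _ _ hc)
    rintro _ ⟨u, hu, rfl⟩
    exact hu
  have hc : ∀ c ∈ C, ∀ k, Commute (incl Γ G {v}ᶜ c) (of Γ G v k) := by
    intro c hc k
    have : vsub Γ G {u | Γ.Adj v u} ≤ Subgroup.centralizer {of Γ G v k} := by
      refine vsub_le fun u hu g => ?_
      rw [Subgroup.mem_centralizer_singleton_iff]
      exact (of_comm hu k g).symm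
    exact Subgroup.mem_centralizer_singleton_iff.1 (this (hLC c hc))
  let θ : GraphProduct Γ G →* FP (A ⧸ C) (G v) ⋊[perm (A ⧸ C) (G v) A] A :=
    lft (fun u => if h : u = v then
        (h.symm ▸ (SemidirectProduct.inl.comp (inc ((1 : A) : A ⧸ C)) :
          G v →* FP (A ⧸ C) (G v) ⋊[perm (A ⧸ C) (G v) A] A) :
          G u →* FP (A ⧸ C) (G v) ⋊[perm (A ⧸ C) (G v) A] A)
        else SemidirectProduct.inr.comp
          (of (Γ.induce ({v}ᶜ : Set V)) (fun s : ({v}ᶜ : Set V) => G s) ⟨u, h⟩)) (by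
      have key : ∀ u, ∀ huv : Γ.Adj v u, ∀ (hne : u ≠ v) (k : G v) (g : G u),
          Commute (SemidirectProduct.inl (inc ((1 : A) : A ⧸ C) k) :
            FP (A ⧸ C) (G v) ⋊[perm (A ⧸ C) (G v) A] A)
          (SemidirectProduct.inr (of (Γ.induce ({v}ᶜ : Set V))
            (fun s : ({v}ᶜ : Set V) => G s) ⟨u, hne⟩ g)) := by
        intro u huv hne k g
        set a : A := of (Γ.induce ({v}ᶜ : Set V)) (fun s : ({v}ᶜ : Set V) => G s) ⟨u, hne⟩ g
        have ha : a ∈ C := of_mem_vsub (Γ := Γ.induce ({v}ᶜ : Set V))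
          (G := fun s : ({v}ᶜ : Set V) => G s) (v := ⟨u, hne⟩) huv g
        have hfix : a • ((1 : A) : A ⧸ C) = ((1 : A) : A ⧸ C) := by
          change ((a * 1 : A) : A ⧸ C) = _
          rw [mul_one, eq_comm, QuotientGroup.eq]
          simpa using ha
        have := SemidirectProduct.inl_aut (φ := perm (A ⧸ C) (G v) A) a
          (inc ((1 : A) : A ⧸ C) k)
        rw [perm_inc, hfix, map_inv, eq_mul_inv_iff_mul_eq] at this
        exact this
      intro u w huw g h
      by_cases hu : u = v
      · subst hu
        have hw : w ≠ u := huw.ne'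
        simp only [hw, dif_pos, dif_neg, not_false_eq_true]
        exact key w huw hw g h
      · by_cases hw : w = v
        · subst hw
          simp only [hu, dif_pos, dif_neg, not_false_eq_true]
          exact (key u huw.symm hu h g).symm
        · simp only [hu, hw, dif_neg, not_false_eq_true]
          exact (of_comm (Γ := Γ.induce ({v}ᶜ : Set V)) (G := fun s : ({v}ᶜ : Set V) => G s)
            (u := ⟨u, hu⟩) (v := ⟨w, hw⟩) huw g h).map SemidirectProduct.inr)
  have hθ : ∀ w, sig C (incl Γ G {v}ᶜ) (of Γ G v) hc (θ w) = w := by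
    intro w
    refine hom_ext' (f := (sig C (incl Γ G {v}ᶜ) (of Γ G v) hc).comp θ) (g := MonoidHom.id _) ?_ w
    intro u k
    simp only [MonoidHom.comp_apply, MonoidHom.id_apply, θ, lft_of]
    by_cases hu : u = v
    · subst hu
      simp only [dif_pos, MonoidHom.comp_apply]
      rw [sig_inl, conjHom_mk]
      simp
    · simp only [hu, dif_neg, not_false_eq_true, MonoidHom.comp_apply]
      rw [sig_inr, incl_of]
  obtain ⟨s, h | h⟩ := split C (incl Γ G {v}ᶜ) (of Γ G v) hc θ hθ H
  · exact ⟨s, Or.inl h⟩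
  · refine ⟨s, Or.inr fun x hx => ?_⟩
    obtain ⟨k, c, hc, e⟩ := h x hx
    exact ⟨k, _, hLC c hc, e⟩

lemma retr_incl (S : Set V) (x) : retr Γ G S (incl Γ G S x) = x := by
  refine hom_ext' (f := (retr Γ G S).comp (incl Γ G S)) (g := MonoidHom.id _) ?_ x
  intro v k
  rw [MonoidHom.comp_apply, incl_of, retr_of_mem v.2]; rfl

lemma incl_retr (S : Set V) {x} (hx : x ∈ vsub Γ G S) : incl Γ G S (retr Γ G S x) = x := by
  have : vsub Γ G S ≤ MonoidHom.eqLocus ((incl Γ G S).comp (retr Γ G S)) (MonoidHom.id _) := by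
    refine vsub_le fun v hv g => ?_
    change incl Γ G S (retr Γ G S (of Γ G v g)) = of Γ G v g
    rw [retr_of_mem hv, incl_of]
  exact this hx

end GP

universe u w

open GraphProduct in
/-- Finite subgroups of graph products are conjugate into clique subgroups. -/
theorem fin_conj (n : ℕ) : ∀ {V : Type u} [Finite V] (Γ : SimpleGraph V) (G : V → Type w)
    [∀ v, Group (G v)], Nat.card V = n → ∀ (H : Subgroup (GraphProduct Γ G)) [Finite H],
    ∃ D : Set V, Γ.IsClique D ∧ ∃ s, ∀ h ∈ H, s⁻¹ * h * s ∈ vsub Γ G D := by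
  induction n using Nat.strong_induction_on with
  | _ n ih =>
  intro V _ Γ G _ hn H _
  rcases isEmpty_or_nonempty V with hV | ⟨⟨v⟩⟩
  · refine ⟨∅, by simp, 1, fun h _ => gen _ (fun v => (hV.false v).elim) _⟩
  have hlt : ∀ S : Set V, v ∉ S → Nat.card S < n := by
    intro S hS
    rw [← hn]
    refine lt_of_lt_of_eq (Set.ncard_lt_ncard (t := Set.univ) ?_) (Set.ncard_univ V)
    exact Set.ssubset_univ_iff.2 (fun h => hS (h ▸ trivial))
  obtain ⟨s, h1 | h1⟩ := split_vertex v H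
  · let S : Set V := {v}ᶜ
    let e : GraphProduct Γ G →* GraphProduct (Γ.induce S) (fun s : S => G s) :=
      (retr Γ G S).comp (MulAut.conj s⁻¹).toMonoidHom
    have hfin : Finite (H.map e) := Finite.of_surjective _ (e.subgroupMap_surjective H)
    obtain ⟨D, hD, t, ht⟩ := ih _ (hlt S (by simp [S])) (Γ.induce S) (fun s : S => G s) rfl (H.map e)
    refine ⟨Subtype.val '' D, ?_, s * incl Γ G S t, ?_⟩
    · rintro _ ⟨a, ha, rfl⟩ _ ⟨b, hb, rfl⟩ hab
      exact hD ha hb (fun h => hab (by rw [h]))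
    · intro h hh
      obtain ⟨a, ha⟩ := h1 h hh
      have h2 := incl_vsub _ _ (ht (e h) ⟨h, hh, rfl⟩)
      have h3 : incl Γ G S (e h) = s⁻¹ * h * s := by
        simp only [e, MonoidHom.comp_apply, MulEquiv.coe_toMonoidHom, MulAut.conj_apply, inv_inv]
        rw [ha, retr_incl]
      rw [map_mul, map_mul, h3, map_inv] at h2
      convert h2 using 1
      group
  · let S : Set V := {u | Γ.Adj v u}
    let e : GraphProduct Γ G →* GraphProduct (Γ.induce S) (fun s : S => G s) :=
      (retr Γ G S).comp (MulAut.conj s⁻¹).toMonoidHom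
    have hvS : v ∉ S := by simp [S]
    have hfin : Finite (H.map e) := Finite.of_surjective _ (e.subgroupMap_surjective H)
    obtain ⟨D, hD, t, ht⟩ := ih _ (hlt S hvS) (Γ.induce S) (fun s : S => G s) rfl (H.map e)
    refine ⟨insert v (Subtype.val '' D), ?_, s * incl Γ G S t, ?_⟩
    · rw [SimpleGraph.isClique_insert]
      refine ⟨?_, ?_⟩
      · rintro _ ⟨a, ha, rfl⟩ _ ⟨b, hb, rfl⟩ hab
        exact hD ha hb (fun h => hab (by rw [h]))
      · rintro _ ⟨b, hb, rfl⟩ _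
        exact b.2
    · intro h hh
      obtain ⟨k, c, hc, ha⟩ := h1 h hh
      have h2 := incl_vsub _ _ (ht (e h) ⟨h, hh, rfl⟩)
      have h3 : incl Γ G S (e h) = c := by
        simp only [e, MonoidHom.comp_apply, MulEquiv.coe_toMonoidHom, MulAut.conj_apply, inv_inv]
        rw [ha, map_mul, retr_of_not_mem hvS, one_mul, incl_retr _ hc]
      rw [map_mul, map_mul, h3, map_inv] at h2
      have hcomm : ∀ y, Commute (incl Γ G S y) (of Γ G v k) := by
        intro y
        have : y ∈ (Subgroup.centralizer {of Γ G v k}).comap (incl Γ G S) := by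
          refine gen _ ?_ y
          intro u g
          rw [Subgroup.mem_comap, incl_of, Subgroup.mem_centralizer_singleton_iff]
          exact (of_comm u.2 k g).symm
        exact Subgroup.mem_centralizer_singleton_iff.1 this
      have h4 : (s * incl Γ G S t)⁻¹ * h * (s * incl Γ G S t) =
          of Γ G v k * ((incl Γ G S t)⁻¹ * c * incl Γ G S t) := by
        calc _ = (incl Γ G S t)⁻¹ * (s⁻¹ * h * s) * incl Γ G S t := by group
          _ = _ := by
            rw [ha, ← mul_assoc, (hcomm t).inv_left.eq]; group
      rw [h4]
      exact Subgroup.mul_mem _ (of_mem_vsub (Set.mem_insert _ _) _)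
        (vsub_mono (Set.subset_insert _ _) h2)

/-! ### Projections and clique subgroups -/

section Proj

open GraphProduct

variable {V : Type u} {Γ : SimpleGraph V} {G : V → Type w} [∀ v, Group (G v)]

open Classical in
variable (Γ G) in
/-- Projection to a vertex group. -/
noncomputable def proj (v : V) : GraphProduct Γ G →* G v :=
  lft (fun u => if h : u = v then (h ▸ MonoidHom.id (G u) : G u →* G v) else 1) (by
    intro a b hab g h
    by_cases ha : a = v
    · have hb : b ≠ v := fun hb => hab.ne (ha.trans hb.symm)
      simp [hb]
    · simp [ha])

lemma proj_same (v : V) (k : G v) : proj Γ G v (of Γ G v k) = k := by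
  rw [proj, lft_of]; simp

lemma proj_ne {u v : V} (h : u ≠ v) (k : G u) : proj Γ G v (of Γ G u k) = 1 := by
  rw [proj, lft_of]; simp [h]

lemma proj_conj (v : V) (g x : GraphProduct Γ G) :
    proj Γ G v (g⁻¹ * x * g) = 1 ↔ proj Γ G v x = 1 := by
  simp only [map_mul, map_inv]
  constructor
  · intro h
    rwa [mul_assoc, inv_mul_eq_one, eq_comm, mul_eq_right] at h
  · intro h
    rw [h]; simp

lemma proj_vsub {D : Set V} {v : V} (hv : v ∉ D) {x} (hx : x ∈ vsub Γ G D) :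
    proj Γ G v x = 1 := by
  have : vsub Γ G D ≤ (proj Γ G v).ker := vsub_le fun u hu k => by
    rw [MonoidHom.mem_ker]
    by_cases h : u = v
    · subst h; exact absurd hu hv
    · first | exact proj_ne h k | exact proj_ne (Ne.symm h) k
  exact this hx

variable [Finite V]

lemma prod_mem' {D : Set V} (hD : Γ.IsClique D) {y} (hy : y ∈ vsub Γ G D)
    (S : Subgroup (GraphProduct Γ G)) (h : ∀ w ∈ D, of Γ G w (proj Γ G w y) ∈ S) : y ∈ S := by
  classical
  have := Fintype.ofFinite D
  have hcomm : Pairwise fun i j : D => ∀ (x : G i) (y : G j),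
      Commute (of Γ G i x) (of Γ G j y) := by
    intro i j hij x y
    exact of_comm (hD i.2 j.2 (fun h => hij (Subtype.ext h))) x y
  let F := MonoidHom.noncommPiCoprod (fun i : D => of Γ G i) hcomm
  have hr : F.range = vsub Γ G D := by
    rw [MonoidHom.noncommPiCoprod_range, vsub, iSup_subtype']
  rw [← hr] at hy
  obtain ⟨f, rfl⟩ := hy
  have hp : ∀ w : D, proj Γ G w (F f) = f w := by
    intro w
    have : (proj Γ G w).comp F = Pi.evalMonoidHom (fun i : D => G i) w := by
      refine MonoidHom.pi_ext fun i x => ?_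
      rw [MonoidHom.comp_apply, MonoidHom.noncommPiCoprod_mulSingle]
      by_cases hi : i = w
      · subst hi
        simp [proj_same]
      · rw [proj_ne (fun h => hi (Subtype.ext h))]
        simp [Pi.mulSingle_eq_of_ne (Ne.symm hi)]
    exact DFunLike.congr_fun this f
  change MonoidHom.noncommPiCoprod (fun i : D => of Γ G i) hcomm f ∈ S
  rw [MonoidHom.noncommPiCoprod_apply]
  refine Subgroup.noncommProd_mem _ _ fun w _ => ?_
  have := h w w.2
  rwa [hp w] at this

lemma finite_vsub [∀ v, Finite (G v)] {D : Set V} (hD : Γ.IsClique D) :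
    Finite (vsub Γ G D) := by
  let F : vsub Γ G D →* (∀ v, G v) := (Pi.monoidHom fun v => proj Γ G v).comp (vsub Γ G D).subtype
  refine Finite.of_injective F ?_
  rw [injective_iff_map_eq_one]
  intro y hy
  have h1 := prod_mem' hD y.2 ⊥ (by
    intro w _
    have : proj Γ G w y = 1 := congrFun hy w
    rw [this, map_one]
    exact Subgroup.one_mem _)
  exact Subtype.ext (Subgroup.mem_bot.1 h1)

lemma cover (A : Subgroup (GraphProduct Γ G)) [Finite A] :
    ∃ D : Set V, Γ.IsClique D ∧ (∃ s, ∀ h ∈ A, s⁻¹ * h * s ∈ vsub Γ G D) ∧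
      ∀ x g, g⁻¹ * x * g ∈ A → ∀ v, proj Γ G v x ≠ 1 → v ∈ D := by
  obtain ⟨D, hD, s, hs⟩ := fin_conj _ Γ G rfl A
  refine ⟨D, hD, ⟨s, hs⟩, fun x g hx v hv => ?_⟩
  by_contra hvD
  have := proj_vsub hvD (hs _ hx)
  rw [proj_conj, proj_conj] at this
  exact hv this

lemma tors_conj {x : GraphProduct Γ G} (hx : IsOfFinOrder x) :
    ∃ D : Set V, Γ.IsClique D ∧ ∃ s, s⁻¹ * x * s ∈ vsub Γ G D := by
  have : Finite (Subgroup.zpowers x) := finite_zpowers.2 hx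
  obtain ⟨D, hD, ⟨s, hs⟩, _⟩ := cover (Subgroup.zpowers x)
  exact ⟨D, hD, s, hs x (Subgroup.mem_zpowers x)⟩

end Proj

/-! ### Maximal finite subgroups -/

/-- The maximal finite subgroups containing a conjugate of `x`. -/
def MS {W : Type*} [Group W] (x : W) : Set (Subgroup W) :=
  {A | Maximal (fun B : Subgroup W => Finite B) A ∧ ∃ g, g⁻¹ * x * g ∈ A}

section MSet

variable {W W' : Type*} [Group W] [Group W']

lemma MS_conj_le (x g : W) : MS x ⊆ MS (g⁻¹ * x * g) := by
  rintro A ⟨hA, t, ht⟩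
  refine ⟨hA, g⁻¹ * t, ?_⟩
  convert ht using 1
  group

lemma MS_conj (x g : W) : MS (g⁻¹ * x * g) = MS x := by
  refine Set.Subset.antisymm ?_ (MS_conj_le x g)
  have := MS_conj_le (g⁻¹ * x * g) g⁻¹
  convert this using 2
  group

lemma finite_map (e : W ≃* W') (A : Subgroup W) [Finite A] : Finite (A.map e.toMonoidHom) :=
  Finite.of_surjective _ (e.toMonoidHom.subgroupMap_surjective A)

lemma map_map_symm (e : W ≃* W') (B : Subgroup W') :
    (B.map e.symm.toMonoidHom).map e.toMonoidHom = B := by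
  ext x
  simp [Subgroup.mem_map]

lemma MS_map_mem (e : W ≃* W') {x : W} {A : Subgroup W} (h : A ∈ MS x) :
    A.map e.toMonoidHom ∈ MS (e x) := by
  obtain ⟨hA, g, hg⟩ := h
  have := hA.prop
  refine ⟨⟨finite_map e A, fun B hB hle => ?_⟩, e g, ?_⟩
  · have : Finite B := hB
    have h1 : Finite (B.map e.symm.toMonoidHom) := finite_map e.symm B
    have h2 : A ≤ B.map e.symm.toMonoidHom := by
      intro a ha
      exact ⟨e a, hle ⟨a, ha, rfl⟩, e.symm_apply_apply a⟩
    have h3 := hA.le_of_ge h1 h2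
    rw [← map_map_symm e B]
    exact Subgroup.map_mono h3
  · exact ⟨_, hg, by simp⟩

lemma MS_map_sub (e : W ≃* W') {x y : W} (h : MS x ⊆ MS y) : MS (e x) ⊆ MS (e y) := by
  intro B hB
  have h1 := MS_map_mem e.symm hB
  rw [e.symm_apply_apply] at h1
  have h2 := MS_map_mem e (h h1)
  rwa [map_map_symm] at h2

lemma MS_map_eq (e : W ≃* W') {x y : W} (h : MS x = MS y) : MS (e x) = MS (e y) :=
  (MS_map_sub e h.subset).antisymm (MS_map_sub e h.superset)

end MSet

section Main

open GraphProduct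

variable {V : Type*} [Finite V] {Γ : SimpleGraph V} {G : V → Type*} [∀ v, Group (G v)]
  [∀ v, Finite (G v)]

lemma MS_mono {x y : GraphProduct Γ G} (hy : IsOfFinOrder y)
    (h : ∀ v, proj Γ G v y ≠ 1 → proj Γ G v x ≠ 1) : MS x ⊆ MS y := by
  rintro A ⟨hA, g, hg⟩
  have := hA.prop
  obtain ⟨D, hD, ⟨s, hs⟩, hsupp⟩ := cover A
  obtain ⟨E, hE, t, ht⟩ := tors_conj hy
  have := finite_vsub (G := G) hD
  let B := (vsub Γ G D).map (MulAut.conj s).toMonoidHom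
  have hB : Finite B := finite_map (MulAut.conj s) _
  have hAB : A ≤ B := by
    intro a ha
    refine ⟨_, hs a ha, ?_⟩
    simp [mul_assoc]
  have hBA := hA.le_of_ge hB hAB
  have hyD : t⁻¹ * y * t ∈ vsub Γ G D := by
    refine prod_mem' hE ht _ fun w _ => ?_
    by_cases hw : proj Γ G w (t⁻¹ * y * t) = 1
    · rw [hw, map_one]; exact Subgroup.one_mem _
    · rw [proj_conj] at hw
      exact of_mem_vsub (hsupp x g hg w (h w hw)) _
  refine ⟨hA, t * s⁻¹, hBA ⟨_, hyD, ?_⟩⟩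
  simp [mul_assoc]

lemma max_finite {C : Set V} (hC : Maximal (fun D => Γ.IsClique D) C) [∀ v, Nontrivial (G v)] :
    Maximal (fun B : Subgroup (GraphProduct Γ G) => Finite B) (vsub Γ G C) := by
  refine ⟨finite_vsub hC.prop, fun B hB hle => ?_⟩
  have : Finite B := hB
  obtain ⟨D, hD, ⟨s, hs⟩, hsupp⟩ := cover B
  have hCD : C ⊆ D := by
    intro v hv
    obtain ⟨k, hk⟩ := exists_ne (1 : G v)
    refine hsupp (of Γ G v k) 1 ?_ v (by rwa [proj_same])
    simpa using hle (of_mem_vsub hv k)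
  have hDC : D ⊆ C := hC.le_of_ge hD hCD
  have hfin := finite_vsub (G := G) hC.prop
  have hcard : Nat.card B ≤ Nat.card (vsub Γ G C) := by
    refine Nat.card_le_card_of_injective
      (fun b : B => (⟨s⁻¹ * b * s, vsub_mono hDC (hs b b.2)⟩ : vsub Γ G C)) ?_
    intro a b hab
    simpa using congrArg Subtype.val hab
  exact (Subgroup.eq_of_le_of_card_ge hle hcard).ge

lemma exists_max {C : Set V} (hC : Γ.IsClique C) :
    ∃ D, C ⊆ D ∧ Maximal (fun D => Γ.IsClique D) D :=
  Finite.exists_le_maximal (p := fun D : Set V => Γ.IsClique D) hC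

variable [∀ v, Nontrivial (G v)]

lemma mem_MS {C : Set V} (hC : Maximal (fun D => Γ.IsClique D) C) {v : V} {k : G v} (hk : k ≠ 1) :
    vsub Γ G C ∈ MS (of Γ G v k) ↔ v ∈ C := by
  constructor
  · rintro ⟨-, g, hg⟩
    by_contra hv
    have := proj_vsub hv hg
    rw [proj_conj, proj_same] at this
    exact hk this
  · intro hv
    exact ⟨max_finite hC, 1, by simpa using of_mem_vsub hv k⟩

lemma tors_of (v : V) (k : G v) : IsOfFinOrder (of Γ G v k) :=
  (of Γ G v).isOfFinOrder (isOfFinOrder_of_finite k)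

lemma MS_of_eq {v : V} {k l : G v} (hk : k ≠ 1) (hl : l ≠ 1) :
    MS (of Γ G v k) = MS (of Γ G v l) := by
  have : ∀ {k l : G v}, k ≠ 1 → MS (of Γ G v k) ⊆ MS (of Γ G v l) := by
    intro k l hk
    refine MS_mono (tors_of v l) fun w hw => ?_
    by_cases h : v = w
    · subst h; rwa [proj_same]
    · exact absurd (proj_ne h l) hw
  exact (this hk).antisymm (this hl)

lemma MS_inj (hT0 : ∀ u v : V, Γ.Adj u v →
      ∃ w : V, w ≠ u ∧ w ≠ v ∧ Xor' (Γ.Adj w u) (Γ.Adj w v))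
    {u v : V} {k : G u} {l : G v} (hk : k ≠ 1) (hl : l ≠ 1)
    (h : MS (of Γ G u k) = MS (of Γ G v l)) : u = v := by
  by_contra hne
  have hiff : ∀ C, Maximal (fun D => Γ.IsClique D) C → (u ∈ C ↔ v ∈ C) := by
    intro C hC
    rw [← mem_MS hC hk, ← mem_MS hC hl, h]
  obtain ⟨C, hC, hCm⟩ := exists_max (Γ := Γ) (C := {u}) (by simp)
  have hu : u ∈ C := hC rfl
  have hadj : Γ.Adj u v := hCm.prop hu ((hiff C hCm).1 hu) hne
  obtain ⟨w, hwu, hwv, hx⟩ := hT0 u v hadj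
  rcases hx with ⟨h1, h2⟩ | ⟨h1, h2⟩
  · obtain ⟨C, hC, hCm⟩ := exists_max (Γ := Γ) (C := {w, u}) (by
      rw [SimpleGraph.isClique_pair]; exact fun _ => h1)
    exact h2 (hCm.prop (hC (by simp)) ((hiff C hCm).1 (hC (by simp))) hwv)
  · obtain ⟨C, hC, hCm⟩ := exists_max (Γ := Γ) (C := {w, v}) (by
      rw [SimpleGraph.isClique_pair]; exact fun _ => h1)
    exact h2 (hCm.prop (hC (by simp)) ((hiff C hCm).2 (hC (by simp))) hwu)

lemma MS_adj {u v : V} (hne : u ≠ v) {k : G u} {l : G v} (hk : k ≠ 1) (hl : l ≠ 1) :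
    Γ.Adj u v ↔ ∃ A, A ∈ MS (of Γ G u k) ∧ A ∈ MS (of Γ G v l) := by
  constructor
  · intro h
    obtain ⟨C, hC, hCm⟩ := exists_max (Γ := Γ) (C := {u, v}) (by
      rw [SimpleGraph.isClique_pair]; exact fun _ => h)
    exact ⟨vsub Γ G C, (mem_MS hCm hk).2 (hC (by simp)), (mem_MS hCm hl).2 (hC (by simp))⟩
  · rintro ⟨A, ⟨hA, g, hg⟩, ⟨-, g', hg'⟩⟩
    have := hA.prop
    obtain ⟨D, hD, -, hsupp⟩ := cover A
    exact hD (hsupp _ _ hg u (by rwa [proj_same])) (hsupp _ _ hg' v (by rwa [proj_same])) hne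

variable {V' : Type*} [Finite V'] {Γ' : SimpleGraph V'} {G' : V' → Type*} [∀ v, Group (G' v)]
  [∀ v, Finite (G' v)] [∀ v, Nontrivial (G' v)]

lemma transport (e : GraphProduct Γ G ≃* GraphProduct Γ' G') {v : V} {k : G v} (hk : k ≠ 1) :
    ∃ u, proj Γ' G' u (e (of Γ G v k)) ≠ 1 ∧
      ∀ l : G' u, l ≠ 1 → MS (of Γ' G' u l) = MS (e (of Γ G v k)) := by
  have htors : IsOfFinOrder (e (of Γ G v k)) := e.toMonoidHom.isOfFinOrder (tors_of v k)
  obtain ⟨D, hD, s, hs⟩ := tors_conj htors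
  set y := s⁻¹ * e (of Γ G v k) * s with hy
  have hMy : MS y = MS (e (of Γ G v k)) := MS_conj _ _
  have hle : ∀ w, MS y ⊆ MS (of Γ' G' w (proj Γ' G' w y)) := by
    intro w
    refine MS_mono (tors_of w _) fun w' hw' => ?_
    by_cases h : w = w'
    · subst h; rwa [proj_same] at hw'
    · exact absurd (proj_ne h _) hw'
  by_contra hcon
  push Not at hcon
  have key : ∀ w, proj Γ G v (e.symm (of Γ' G' w (proj Γ' G' w y))) = 1 := by
    intro w
    by_contra hne
    have hw : proj Γ' G' w y ≠ 1 := by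
      intro h
      rw [h] at hne
      simp at hne
    have h1 : MS (e.symm (of Γ' G' w (proj Γ' G' w y))) ⊆ MS (of Γ G v k) := by
      refine MS_mono (tors_of v k) fun w' hw' => ?_
      by_cases h : v = w'
      · subst h; exact hne
      · exact absurd (proj_ne h _) hw'
    have h2 := MS_map_sub e h1
    rw [e.apply_symm_apply, ← hMy] at h2
    have heq := (hle w).antisymm h2
    obtain ⟨l, hl, hl2⟩ := hcon w (by rwa [hy, Ne, proj_conj] at hw)
    apply hl2
    rw [MS_of_eq hl hw, ← heq, hMy]
  have hmem := prod_mem' hD hs ((proj Γ G v).comp e.symm.toMonoidHom).ker (fun w _ => key w)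
  have h3 : proj Γ G v (e.symm y) = 1 := hmem
  have h4 : e.symm y = (e.symm s)⁻¹ * of Γ G v k * e.symm s := by
    rw [hy]; simp
  rw [h4, proj_conj, proj_same] at h3
  exact hk h3

lemma embed (hT0' : ∀ u v : V', Γ'.Adj u v →
      ∃ w : V', w ≠ u ∧ w ≠ v ∧ Xor' (Γ'.Adj w u) (Γ'.Adj w v))
    (e : GraphProduct Γ G ≃* GraphProduct Γ' G') (v : V) (u : V') (k0 : G v) (l0 : G' u)
    (hk0 : k0 ≠ 1) (hl0 : l0 ≠ 1) (h : MS (of Γ' G' u l0) = MS (e (of Γ G v k0))) :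
    Function.Injective ((proj Γ' G' u).comp (e.toMonoidHom.comp (of Γ G v))) := by
  rw [injective_iff_map_eq_one]
  intro k hk
  by_contra hk1
  obtain ⟨u', hu', hMS⟩ := transport e hk1
  obtain ⟨l, hl⟩ := exists_ne (1 : G' u')
  have h1 := hMS l hl
  rw [MS_map_eq e (MS_of_eq hk1 hk0), ← h] at h1
  have := MS_inj hT0' hl hl0 h1
  subst this
  exact hu' hk

end Main

end GPR

/-- If `Γ` and `Γ'` are `T₀` graphs and the graph products of `(Γ, G)` and
`(Γ', G')` (with nontrivial finite vertex groups) are isomorphic, then there is a graph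
isomorphism `ψ : Γ ≃g Γ'` with `G_v ≅ G'_{ψ v}` for all `v`. -/
theorem graphProduct_rigidity_T0 {V V' : Type*} [Fintype V] [Fintype V']
    (Γ : SimpleGraph V) (Γ' : SimpleGraph V')
    (G : V → Type*) [∀ v, Group (G v)] [∀ v, Finite (G v)] [∀ v, Nontrivial (G v)]
    (G' : V' → Type*) [∀ v', Group (G' v')] [∀ v', Finite (G' v')] [∀ v', Nontrivial (G' v')]
    (hT0 : ∀ u v : V, Γ.Adj u v →
      ∃ w : V, w ≠ u ∧ w ≠ v ∧ Xor' (Γ.Adj w u) (Γ.Adj w v))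
    (hT0' : ∀ u v : V', Γ'.Adj u v →
      ∃ w : V', w ≠ u ∧ w ≠ v ∧ Xor' (Γ'.Adj w u) (Γ'.Adj w v))
    (hiso : Nonempty (GraphProduct Γ G ≃* GraphProduct Γ' G')) :
    ∃ ψ : Γ ≃g Γ', ∀ v : V, Nonempty (G v ≃* G' (ψ v)) := by
  classical
  obtain ⟨e⟩ := hiso
  choose k hk using fun v => exists_ne (1 : G v)
  choose k' hk' using fun v => exists_ne (1 : G' v)
  choose ψ _ hψ using fun v => GPR.transport e (hk v)
  choose χ _ hχ using fun v => GPR.transport e.symm (hk' v)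
  have hχψ : ∀ v, χ (ψ v) = v := by
    intro v
    refine GPR.MS_inj hT0 (hk _) (hk v) ?_
    have h := GPR.MS_map_eq e.symm (hψ v _ (hk' _))
    rw [hχ _ _ (hk _), h, e.symm_apply_apply]
  have hψχ : ∀ v, ψ (χ v) = v := by
    intro v
    refine GPR.MS_inj hT0' (hk' _) (hk' v) ?_
    have h := GPR.MS_map_eq e (hχ v _ (hk _))
    rw [hψ _ _ (hk' _), h, e.apply_symm_apply]
  refine ⟨⟨⟨ψ, χ, hχψ, hψχ⟩, ?_⟩, ?_⟩
  · intro u v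
    change Γ'.Adj (ψ u) (ψ v) ↔ Γ.Adj u v
    by_cases huv : u = v
    · subst huv; simp
    have hne : ψ u ≠ ψ v := fun h => huv (by rw [← hχψ u, h, hχψ])
    rw [GPR.MS_adj hne (hk' _) (hk' _), GPR.MS_adj huv (hk u) (hk v), hψ u _ (hk' _),
      hψ v _ (hk' _)]
    constructor
    · rintro ⟨A, h1, h2⟩
      have h1 := GPR.MS_map_mem e.symm h1
      have h2 := GPR.MS_map_mem e.symm h2
      rw [e.symm_apply_apply] at h1 h2
      exact ⟨_, h1, h2⟩
    · rintro ⟨A, h1, h2⟩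
      exact ⟨_, GPR.MS_map_mem e h1, GPR.MS_map_mem e h2⟩
  · intro v
    change Nonempty (G v ≃* G' (ψ v))
    have i1 := GPR.embed hT0' e v (ψ v) _ _ (hk v) (hk' _) (hψ v _ (hk' _))
    have i2 := GPR.embed hT0 e.symm (ψ v) (χ (ψ v)) _ _ (hk' _) (hk _) (hχ (ψ v) _ (hk _))
    have hc : Nat.card (G' (ψ v)) ≤ Nat.card (G v) := by
      have := Nat.card_le_card_of_injective _ i2
      rwa [hχψ] at this
    exact ⟨MulEquiv.ofBijective _ (i1.bijective_of_nat_card_le hc)⟩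
end
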